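/- arXiv:1308.6451 — 2 statements merged into one kernel-verified Lean document; each statement's English description precedes it below -/
import Mathlib

section
/- For every integer q > 1 and every integer a with 1 ≤ a < q and gcd(a, q) = 1, the real number ψ(a/q) + γ is transcendental. -/
/-- The digamma function `ψ(x) = -γ - 1/x + ∑_{n=1}^∞ (1/n - 1/(n+x))` for real `x`. -/
noncomputable def digamma (x : ℝ) : ℝ :=
  -Real.eulerMascheroniConstant - 1 / x +
    ∑' k : ℕ, (1 / ((k : ℝ) + 1) - 1 / (((k : ℝ) + 1) + x))

open Polynomial in
/-- An exponential polynomial `∑ c ∈ S, Q c (l) * c ^ l` that vanishes at as many consecutive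
integers as it has coefficients is identically zero. -/
theorem expPoly_eq_zero_of_vanish (S : Finset ℂ) (hS : ∀ c ∈ S, c ≠ 0) (k : ℕ) :
    ∀ (Q : ℂ → ℂ[X]) (d : ℂ → ℕ), ∑ c ∈ S, d c = k → (∀ c ∈ S, (Q c).degree < d c) →
      (∀ l < k, ∑ c ∈ S, (Q c).eval (l : ℂ) * c ^ l = 0) → ∀ c ∈ S, Q c = 0 := by
  classical
  induction k with
  | zero =>
    intro Q d hd hQ _ c hc
    have := Finset.sum_eq_zero_iff.mp hd c hc
    simpa [this] using hQ c hc
  | succ k ih =>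
    intro Q d hd hQ hz
    obtain ⟨c₀, hc₀, hdc₀⟩ : ∃ c ∈ S, d c ≠ 0 := by
      by_contra! h
      rw [Finset.sum_eq_zero h] at hd
      omega
    have hlt : ∀ c ∈ S, (C c * (Q c).comp (X + 1) - C c₀ * Q c).degree < d c := by
      intro c hc
      have hshift : ((Q c).comp (X + 1)).degree = (Q c).degree := by
        have := Polynomial.degree_taylor (Q c) 1
        simpa [Polynomial.taylor_apply] using this
      refine lt_of_le_of_lt (degree_sub_le _ _) (max_lt ?_ ?_)
      · exact lt_of_le_of_lt (by rw [← smul_eq_C_mul]; exact degree_smul_le _ _) (hshift ▸ hQ c hc)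
      · exact lt_of_le_of_lt (by rw [← smul_eq_C_mul]; exact degree_smul_le _ _) (hQ c hc)
    have hcoeff : ∀ c ∈ S, ∀ n : ℕ, (Q c).natDegree = n →
        ((Q c).comp (X + 1)).coeff n = (Q c).coeff n := by
      intro c hc n hn
      have := Polynomial.coeff_taylor_natDegree (R := ℂ) (r := 1) (f := Q c)
      rw [Polynomial.taylor_apply] at this
      subst hn
      rw [show (X + 1 : ℂ[X]) = X + C 1 by simp]
      exact this
    have hsum : ∑ c ∈ S, (if c = c₀ then d c - 1 else d c) = k := by
      rw [← Finset.add_sum_erase _ _ hc₀] at hd ⊢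
      rw [Finset.sum_congr rfl (g := d) (fun x hx => by simp [Finset.ne_of_mem_erase hx])]
      rw [if_pos rfl]
      lia
    have hdeg : ∀ c ∈ S, (C c * (Q c).comp (X + 1) - C c₀ * Q c).degree <
        ((if c = c₀ then d c - 1 else d c : ℕ) : WithBot ℕ) := by
      intro c hc
      by_cases h : c = c₀
      · subst h
        rw [if_pos rfl]
        by_cases hq0 : Q c = 0
        · simp [hq0]
        have hdeg : (Q c).natDegree < d c := by
          have := hQ c hc
          rwa [degree_eq_natDegree hq0, Nat.cast_lt] at this
        rw [degree_lt_iff_coeff_zero]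
        intro m hm
        rcases eq_or_lt_of_le (show (Q c).natDegree ≤ m by lia) with h | h
        · simp [hcoeff c hc m h]
        · have hcomp : ((Q c).comp (X + 1)).natDegree = (Q c).natDegree := by
            simpa [Polynomial.taylor_apply] using Polynomial.natDegree_taylor (Q c) 1
          simp [coeff_eq_zero_of_natDegree_lt h,
            coeff_eq_zero_of_natDegree_lt (hcomp.symm ▸ h : _ < m)]
      · simpa [h] using hlt c hc
    have key := ih (fun c => C c * (Q c).comp (X + 1) - C c₀ * Q c)
      (fun c => if c = c₀ then d c - 1 else d c) hsum hdeg (by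
        intro l hl
        have h1 := hz (l + 1) (by omega)
        have h2 := hz l (by omega)
        have : ∑ c ∈ S, eval (l : ℂ) (C c * (Q c).comp (X + 1) - C c₀ * Q c) * c ^ l =
            ∑ c ∈ S, (Q c).eval ((l + 1 : ℕ) : ℂ) * c ^ (l + 1) -
              c₀ * ∑ c ∈ S, (Q c).eval (l : ℂ) * c ^ l := by
          rw [Finset.mul_sum, ← Finset.sum_sub_distrib]
          refine Finset.sum_congr rfl fun c _ => ?_
          simp [eval_comp]
          ring
        rw [this, h1, h2]
        simp)
    have hne : ∀ c ∈ S, c ≠ c₀ → Q c = 0 := by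
      intro c hc hcc
      have h := congrArg (fun P => P.coeff (Q c).natDegree) (key c hc)
      simp only [coeff_sub, coeff_C_mul, hcoeff c hc _ rfl, coeff_zero] at h
      rw [← sub_mul] at h
      exact leadingCoeff_eq_zero.mp ((mul_eq_zero.mp h).resolve_left (sub_ne_zero.mpr hcc))
    have hconst : (Q c₀).comp (X + 1) = Q c₀ := by
      have h := key c₀ hc₀
      simp only [← mul_sub] at h
      have := (mul_eq_zero.mp h).resolve_left (by simpa using hS c₀ hc₀)
      exact sub_eq_zero.mp this
    have heval0 : (Q c₀).eval 0 = 0 := by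
      have := hz 0 (by omega)
      rw [Finset.sum_eq_single_of_mem c₀ hc₀ (fun c hc hcc => by simp [hne c hc hcc])] at this
      simpa using this
    have hevalN : ∀ n : ℕ, (Q c₀).eval (n : ℂ) = 0 := by
      intro n
      induction n with
      | zero => simpa using heval0
      | succ n ihn =>
        have := congrArg (fun P => P.eval (n : ℂ)) hconst
        simp only [eval_comp, eval_add, eval_X, eval_one] at this
        rw [Nat.cast_succ, this, ihn]
    intro c hc
    by_cases h : c = c₀
    · subst h
      exact Polynomial.eq_zero_of_infinite_isRoot _
        ((Set.infinite_range_of_injective Nat.cast_injective).mono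
          (by rintro _ ⟨n, rfl⟩; exact hevalN n))
    · exact hne c hc h

/-- A function on the grid `{0, …, E - 1} ^ ι` orthogonal to all monomials of degree less than `E`
in each variable is zero. -/
theorem eq_zero_of_forall_sum_mul_prod_pow_eq_zero {ι : Type*} [Fintype ι] [DecidableEq ι] {E : ℕ}
    (f : (ι → Fin E) → ℂ)
    (h : ∀ m : ι → ℕ, (∀ i, m i < E) → ∑ x, f x * ∏ i, ((x i : ℕ) : ℂ) ^ m i = 0) : f = 0 := by
  classical
  have hinj : Set.InjOn (fun j : Fin E => ((j : ℕ) : ℂ)) (Finset.univ : Finset (Fin E)) :=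
    fun a _ b _ hab => Fin.ext (Nat.cast_injective hab)
  ext y
  let r : ι → Polynomial ℂ := fun i =>
    Lagrange.basis Finset.univ (fun j : Fin E => ((j : ℕ) : ℂ)) (y i)
  have hr : ∀ i, (r i).natDegree < E := by
    intro i
    have hpos : 0 < E := lt_of_le_of_lt (Nat.zero_le _) (y i).2
    have := Lagrange.natDegree_basis (F := ℂ) hinj (Finset.mem_univ (y i))
    simp only [Finset.card_univ, Fintype.card_fin] at this
    simp only [r]
    omega
  have hexp : ∀ x : ι → Fin E, ∏ i, (r i).eval ((x i : ℕ) : ℂ) =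
      ∑ m : ι → Fin E, (∏ i, (r i).coeff (m i)) * ∏ i, ((x i : ℕ) : ℂ) ^ (m i : ℕ) := by
    intro x
    simp_rw [fun i => Polynomial.eval_eq_sum_range' (hr i) (((x i : ℕ) : ℂ))]
    simp_rw [Finset.sum_range fun k => _ * _]
    rw [Finset.prod_univ_sum]
    simp [Finset.prod_mul_distrib]
  have h0 : ∑ x, f x * ∏ i, (r i).eval ((x i : ℕ) : ℂ) = 0 := by
    simp_rw [hexp, Finset.mul_sum]
    rw [Finset.sum_comm]
    refine Finset.sum_eq_zero fun m _ => ?_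
    have := h (fun i => m i) (fun i => (m i).2)
    calc _ = (∏ i, (r i).coeff (m i)) * ∑ x, f x * ∏ i, ((x i : ℕ) : ℂ) ^ (m i : ℕ) := by
          rw [Finset.mul_sum]
          exact Finset.sum_congr rfl fun x _ => by ring
      _ = 0 := by rw [this, mul_zero]
  rw [Finset.sum_eq_single y] at h0
  · have : ∏ i, (r i).eval ((y i : ℕ) : ℂ) = 1 :=
      Finset.prod_eq_one fun i _ => Lagrange.eval_basis_self hinj (Finset.mem_univ _)
    simpa [this] using h0
  · intro x _ hxy
    obtain ⟨i, hi⟩ := Function.ne_iff.mp hxy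
    rw [Finset.prod_eq_zero (Finset.mem_univ i), mul_zero]
    exact Lagrange.eval_basis_of_ne (s := Finset.univ)
      (v := fun j : Fin E => ((j : ℕ) : ℂ)) hi.symm (Finset.mem_univ (x i))
  · simp

open Polynomial in
/-- The constant-coefficient differential operator with symbol `P`, applied to the monomial
`X ^ d`. -/
noncomputable def symbolAct {R : Type*} [CommRing R] (P : R[X]) (d : ℕ) : R[X] :=
  ∑ k ∈ Finset.range (d + 1), monomial (d - k) (P.coeff k * (d.descFactorial k : R))

open Polynomial in
/-- The symbol `∏ i, (b i * X + x i) ^ m i`: the operator by which the `m`-th mixed derivative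
acts on the polynomial factor of a term with frequency vector `x`. -/
noncomputable def derivSymbol {R ι : Type*} [CommRing R] [Fintype ι] (b : ι → R) (x m : ι → ℕ) :
    R[X] :=
  ∏ i, (C (b i) * X + C (x i : R)) ^ m i

section SymbolAct

open Polynomial

theorem symbolAct_add {R : Type*} [CommRing R] (P Q : R[X]) (d : ℕ) :
    symbolAct (P + Q) d = symbolAct P d + symbolAct Q d := by
  simp [symbolAct, add_mul, Finset.sum_add_distrib]

theorem symbolAct_C_mul {R : Type*} [CommRing R] (c : R) (P : R[X]) (d : ℕ) :
    symbolAct (C c * P) d = C c * symbolAct P d := by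
  simp [symbolAct, Finset.mul_sum, mul_assoc, C_mul_monomial]

theorem symbolAct_map {R S : Type*} [CommRing R] [CommRing S] (f : R →+* S) (P : R[X]) (d : ℕ) :
    (symbolAct P d).map f = symbolAct (P.map f) d := by
  simp [symbolAct, Polynomial.map_sum]

theorem derivative_symbolAct {R : Type*} [CommRing R] (P : R[X]) (d : ℕ) :
    derivative (symbolAct P d) = symbolAct (X * P) d := by
  simp only [symbolAct, derivative_sum, derivative_monomial]
  rw [Finset.sum_range_succ, Finset.sum_range_succ' _ d]
  simp only [Nat.sub_self, Nat.cast_zero, mul_zero, map_zero, add_zero, coeff_X_mul,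
    coeff_X_mul_zero, zero_mul]
  refine Finset.sum_congr rfl fun k _ => ?_
  rw [Nat.sub_sub, Nat.descFactorial_succ]
  push_cast
  congr 1
  ring

theorem degree_symbolAct_lt {R : Type*} [CommRing R] (P : R[X]) {d D : ℕ} (h : d < D) :
    (symbolAct P d).degree < D := by
  refine lt_of_le_of_lt (degree_sum_le _ _) ?_
  rw [Finset.sup_lt_iff (by simp)]
  intro k _
  refine lt_of_le_of_lt (degree_monomial_le _ _) ?_
  exact_mod_cast lt_of_le_of_lt (Nat.sub_le _ _) h

theorem coeff_symbolAct_self {R : Type*} [CommRing R] (P : R[X]) (d : ℕ) :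
    (symbolAct P d).coeff d = P.coeff 0 := by
  rw [symbolAct, finsetSum_coeff, Finset.sum_eq_single 0]
  · simp
  · intro k hk hk0
    rw [coeff_monomial, if_neg]
    have := Finset.mem_range.mp hk
    omega
  · simp

theorem derivSymbol_map {R S ι : Type*} [CommRing R] [CommRing S] [Fintype ι] (f : R →+* S)
    (b : ι → R) (x m : ι → ℕ) :
    (derivSymbol b x m).map f = derivSymbol (fun i => f (b i)) x m := by
  simp [derivSymbol, Polynomial.map_prod]

theorem coeff_zero_derivSymbol {R ι : Type*} [CommRing R] [Fintype ι]
    (b : ι → R) (x m : ι → ℕ) :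
    (derivSymbol b x m).coeff 0 = ∏ i, (x i : R) ^ m i := by
  simp [derivSymbol, coeff_zero_eq_eval_zero, eval_prod]

theorem derivSymbol_add_single {R ι : Type*} [CommRing R] [Fintype ι] [DecidableEq ι]
    (b : ι → R) (x m : ι → ℕ) (i : ι) :
    derivSymbol b x (m + Pi.single i 1) = (C (b i) * X + C (x i : R)) * derivSymbol b x m := by
  simp only [derivSymbol, Pi.add_apply, pow_add, Finset.prod_mul_distrib]
  rw [mul_comm]
  congr 1
  rw [Finset.prod_eq_single i]
  · simp
  · intro j _ hj
    simp [hj]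
  · simp

theorem sum_norm_coeff_linear_mul_le (b c : ℂ) (P : ℂ[X]) (N : ℕ) :
    ∑ k ∈ Finset.range N, ‖((C b * X + C c) * P).coeff k‖ ≤
      (‖b‖ + ‖c‖) * ∑ k ∈ Finset.range N, ‖P.coeff k‖ := by
  have hX : ∑ k ∈ Finset.range N, ‖(X * P).coeff k‖ ≤ ∑ k ∈ Finset.range N, ‖P.coeff k‖ := by
    cases N with
    | zero => simp
    | succ N =>
      rw [Finset.sum_range_succ', Finset.sum_range_succ]
      simp
  calc _ ≤ ∑ k ∈ Finset.range N, (‖b‖ * ‖(X * P).coeff k‖ + ‖c‖ * ‖P.coeff k‖) := by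
        refine Finset.sum_le_sum fun k _ => ?_
        rw [add_mul, mul_assoc, coeff_add, coeff_C_mul, coeff_C_mul, ← norm_mul, ← norm_mul]
        exact norm_add_le _ _
    _ ≤ _ := by
        rw [Finset.sum_add_distrib, ← Finset.mul_sum, ← Finset.mul_sum, add_mul]
        gcongr

theorem sum_norm_coeff_derivSymbol_le {ι : Type*} [Fintype ι] (b : ι → ℂ) (x m : ι → ℕ)
    {A : ℝ} (hA : ∀ i, ‖b i‖ + x i ≤ A) (N : ℕ) :
    ∑ k ∈ Finset.range N, ‖(derivSymbol b x m).coeff k‖ ≤ A ^ (∑ i, m i) := by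
  classical
  have hpow : ∀ (i : ι) (P : ℂ[X]) (j : ℕ),
      ∑ k ∈ Finset.range N, ‖((C (b i) * X + C (x i : ℂ)) ^ j * P).coeff k‖ ≤
        A ^ j * ∑ k ∈ Finset.range N, ‖P.coeff k‖ := by
    intro i P j
    induction j with
    | zero => simp
    | succ j ih =>
      rw [pow_succ', mul_assoc, pow_succ', mul_assoc]
      refine (sum_norm_coeff_linear_mul_le _ _ _ _).trans ?_
      have hAi : ‖b i‖ + ‖((x i : ℕ) : ℂ)‖ ≤ A := by simpa using hA i
      exact mul_le_mul hAi ih (Finset.sum_nonneg fun _ _ => norm_nonneg _)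
        ((by positivity : (0 : ℝ) ≤ ‖b i‖ + ‖((x i : ℕ) : ℂ)‖).trans hAi)
  have hprod : ∀ s : Finset ι,
      ∑ k ∈ Finset.range N, ‖(∏ i ∈ s, (C (b i) * X + C (x i : ℂ)) ^ m i).coeff k‖ ≤
        A ^ (∑ i ∈ s, m i) := by
    intro s
    induction s using Finset.induction_on with
    | empty =>
      simp only [Finset.prod_empty, Finset.sum_empty, pow_zero, coeff_one]
      calc ∑ k ∈ Finset.range N, ‖if k = 0 then (1 : ℂ) else 0‖
          = ∑ k ∈ Finset.range N, if k = 0 then (1 : ℝ) else 0 :=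
            Finset.sum_congr rfl fun k _ => by split_ifs <;> simp
        _ ≤ 1 := by
            rw [Finset.sum_ite_eq']
            split_ifs <;> simp
    | insert i s hi ih =>
      rw [Finset.prod_insert hi, Finset.sum_insert hi, pow_add]
      refine (hpow i _ _).trans ?_
      have hA0 : 0 ≤ A := le_trans (by positivity) (hA i)
      gcongr
  exact hprod Finset.univ

theorem norm_eval_symbolAct_le (P : ℂ[X]) (d : ℕ) {A D r : ℝ} {z : ℂ} (hd : (d : ℝ) ≤ D)
    (hz : ‖z‖ ≤ r) (hA : ∑ k ∈ Finset.range (d + 1), ‖P.coeff k‖ ≤ A) :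
    ‖(symbolAct P d).eval z‖ ≤ A * (D + r) ^ d := by
  have hr : 0 ≤ r := (norm_nonneg z).trans hz
  have hD : 0 ≤ D := le_trans (Nat.cast_nonneg d) hd
  rw [symbolAct, eval_finsetSum]
  calc _ ≤ ∑ k ∈ Finset.range (d + 1), ‖P.coeff k‖ * (D + r) ^ d := by
        refine norm_sum_le_of_le _ fun k hk => ?_
        have hk : k ≤ d := Nat.lt_succ_iff.mp (Finset.mem_range.mp hk)
        rw [eval_monomial, norm_mul, norm_mul, norm_pow, Complex.norm_natCast, mul_assoc]
        gcongr
        calc (d.descFactorial k : ℝ) * ‖z‖ ^ (d - k) ≤ (D + r) ^ k * (D + r) ^ (d - k) := by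
              gcongr
              · calc (d.descFactorial k : ℝ) ≤ (d : ℝ) ^ k := by
                      exact_mod_cast Nat.descFactorial_le_pow d k
                  _ ≤ (D + r) ^ k := by gcongr; linarith
              · linarith
          _ = (D + r) ^ d := by rw [← pow_add, Nat.add_sub_cancel' hk]
    _ ≤ _ := by
        rw [← Finset.sum_mul]
        gcongr

end SymbolAct

open Polynomial in
/-- Zero estimate: an auxiliary polynomial in `z` and `exp` of several frequencies all of whose
mixed derivatives of order less than `E` in each direction vanish at sufficiently many integers is
zero. -/
theorem auxiliary_coeff_eq_zero {ι : Type*} [Fintype ι] [DecidableEq ι] {D E N : ℕ}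
    (hN : D * E ^ Fintype.card ι ≤ N) (b : ι → ℂ) (w : (ι → Fin E) → ℂ) (hw : ∀ x, w x ≠ 0)
    (p : Fin D × (ι → Fin E) → ℂ)
    (h : ∀ l < N, ∀ m : ι → ℕ, (∀ i, m i < E) →
      ∑ j, p j * (w j.2 ^ l *
        (symbolAct (derivSymbol b (fun i => (j.2 i : ℕ)) m) j.1).eval (l : ℂ)) = 0) :
    p = 0 := by
  classical
  let Q : (ι → ℕ) → ℂ → ℂ[X] := fun m c => ∑ j : Fin D × (ι → Fin E),
    if w j.2 = c then C (p j) * symbolAct (derivSymbol b (fun i => (j.2 i : ℕ)) m) j.1 else 0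
  have hQ : ∀ m : ι → ℕ, (∀ i, m i < E) → ∀ c ∈ Finset.univ.image w, Q m c = 0 := by
    intro m hm
    refine expPoly_eq_zero_of_vanish (Finset.univ.image w) (by simpa using hw) _ (Q m)
      (fun _ => D) rfl ?_ ?_
    · intro c _
      refine mem_degreeLT.mp (Submodule.sum_mem _ fun j _ => ?_)
      split_ifs
      · rw [← smul_eq_C_mul]
        exact Submodule.smul_mem _ _ (mem_degreeLT.mpr (degree_symbolAct_lt _ j.1.2))
      · exact Submodule.zero_mem _
    · intro l hl
      have hl' : l < N := by
        refine lt_of_lt_of_le hl (le_trans ?_ hN)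
        rw [Finset.sum_const, smul_eq_mul, mul_comm]
        refine Nat.mul_le_mul_left _ (Finset.card_image_le.trans ?_)
        simp
      rw [← h l hl' m hm]
      simp only [Q, eval_finsetSum, Finset.sum_mul]
      rw [Finset.sum_comm]
      refine Finset.sum_congr rfl fun j _ => ?_
      rw [Finset.sum_eq_single (w j.2)]
      · simp
        ring
      · intro c _ hc
        simp [hc.symm]
      · simp
  have main : ∀ e : ℕ, ∀ d : Fin D, D - d ≤ e → ∀ x, p (d, x) = 0 := by
    intro e
    induction e with
    | zero =>
      intro d hd
      have := d.2
      omega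
    | succ e ih =>
      intro d hd y
      have hvan := eq_zero_of_forall_sum_mul_prod_pow_eq_zero
        (fun x => if w x = w y then p (d, x) else 0) (by
          intro m hm
          have h0 := congrArg (fun P => P.coeff d)
            (hQ m hm (w y) (Finset.mem_image_of_mem w (Finset.mem_univ y)))
          simp only [Q, finsetSum_coeff, coeff_zero] at h0
          rw [Fintype.sum_prod_type, Finset.sum_eq_single d] at h0
          · refine Eq.trans ?_ h0
            refine Finset.sum_congr rfl fun x _ => ?_
            split_ifs
            · simp [coeff_symbolAct_self, coeff_zero_derivSymbol]
            · simp
          · intro d' _ hd'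
            refine Finset.sum_eq_zero fun x _ => ?_
            split_ifs
            · rcases lt_or_gt_of_ne (fun h => hd' (Fin.ext h) : (d' : ℕ) ≠ d) with hlt | hlt
              · rw [coeff_C_mul, (degree_lt_iff_coeff_zero _ _).mp
                  (degree_symbolAct_lt _ hlt) d le_rfl, mul_zero]
              · have := d'.2
                rw [ih d' (by omega) x]
                simp
            · simp
          · simp)
      simpa using congrFun hvan y
  ext j
  exact main D j.1 (Nat.sub_le _ _) j.2

/-- An entire function vanishing to order `T` at a point is divisible by `(z - s) ^ T`. -/
theorem exists_entire_eq_sub_pow_mul {f : ℂ → ℂ} (hf : Differentiable ℂ f) (s : ℂ) (T : ℕ)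
    (hT : (T : ℕ∞) ≤ analyticOrderAt f s) :
    ∃ g : ℂ → ℂ, Differentiable ℂ g ∧ ∀ z, f z = (z - s) ^ T * g z := by
  obtain ⟨g, hg, hfg⟩ := (natCast_le_analyticOrderAt (hf.analyticAt s)).mp hT
  classical
  let G : ℂ → ℂ := Function.update (fun z => f z / (z - s) ^ T) s (g s)
  have hGne : ∀ z, z ≠ s → G z = f z / (z - s) ^ T := fun z hz => by simp [G, hz]
  refine ⟨G, fun z => ?_, fun z => ?_⟩
  · by_cases hz : z = s
    · subst hz
      refine hg.differentiableAt.congr_of_eventuallyEq ?_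
      filter_upwards [hfg] with y hy
      by_cases hyz : y = z
      · subst hyz
        simp [G]
      · rw [hGne y hyz, hy, smul_eq_mul]
        exact mul_div_cancel_left₀ _ (pow_ne_zero _ (sub_ne_zero.mpr hyz))
    · have hd : DifferentiableAt ℂ (fun z => f z / (z - s) ^ T) z :=
        (hf z).div (by fun_prop) (pow_ne_zero _ (sub_ne_zero.mpr hz))
      refine hd.congr_of_eventuallyEq ?_
      filter_upwards [isOpen_ne.mem_nhds hz] with y hy using hGne y hy
  · by_cases hz : z = s
    · subst hz
      simpa [G] using hfg.self_of_nhds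
    · rw [hGne z hz, mul_div_cancel₀ _ (pow_ne_zero _ (sub_ne_zero.mpr hz))]

/-- An entire function vanishing to order `T` at every point of a finite set is divisible by the
corresponding polynomial. -/
theorem exists_entire_eq_prod_sub_pow_mul (S : Finset ℂ) (T : ℕ) {f : ℂ → ℂ}
    (hf : Differentiable ℂ f) (hT : ∀ s ∈ S, (T : ℕ∞) ≤ analyticOrderAt f s) :
    ∃ g : ℂ → ℂ, Differentiable ℂ g ∧ ∀ z, f z = (∏ s ∈ S, (z - s) ^ T) * g z := by
  classical
  induction S using Finset.induction_on generalizing f with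
  | empty => exact ⟨f, hf, by simp⟩
  | insert s S hs ih =>
    obtain ⟨g, hg, hfg⟩ := exists_entire_eq_sub_pow_mul hf s T (hT s (Finset.mem_insert_self s S))
    obtain ⟨k, hk, hgk⟩ := ih hg (by
      intro r hr
      have hrs : r ≠ s := fun h => hs (h ▸ hr)
      have h := hT r (Finset.mem_insert_of_mem hr)
      have hpow : AnalyticAt ℂ (fun z : ℂ => (z - s) ^ T) r := by fun_prop
      rw [show f = (fun z => (z - s) ^ T) * g from funext hfg,
        analyticOrderAt_mul hpow (hg.analyticAt r),
        hpow.analyticOrderAt_eq_zero.mpr (pow_ne_zero _ (sub_ne_zero.mpr hrs)), zero_add] at h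
      exact h)
    refine ⟨k, hk, fun z => ?_⟩
    rw [hfg, hgk, Finset.prod_insert hs, mul_assoc]

/-- Schwarz lemma for an entire function with many zeros. -/
theorem norm_mul_two_pow_le_of_zeros (S : Finset ℂ) (T : ℕ) {f : ℂ → ℂ}
    (hf : Differentiable ℂ f) (hT : ∀ s ∈ S, (T : ℕ∞) ≤ analyticOrderAt f s)
    {R ρ B : ℝ} (hR : 0 < R) (hρ : 0 < ρ) (hB : ∀ z, ‖z‖ = R → ‖f z‖ ≤ B)
    (hS : ∀ z, ‖z‖ = R → ∀ s ∈ S, 2 * ρ ≤ ‖z - s‖) {w : ℂ} (hw : ‖w‖ ≤ R)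
    (hwS : ∀ s ∈ S, ‖w - s‖ ≤ ρ) :
    ‖f w‖ * 2 ^ (S.card * T) ≤ B := by
  obtain ⟨g, hg, hfg⟩ := exists_entire_eq_prod_sub_pow_mul S T hf hT
  have hgB : ∀ z ∈ frontier (Metric.ball (0 : ℂ) R), ‖g z‖ ≤ B / (2 * ρ) ^ (S.card * T) := by
    intro z hz
    rw [frontier_ball _ hR.ne', mem_sphere_zero_iff_norm] at hz
    rw [le_div_iff₀ (by positivity)]
    refine le_trans ?_ (hB z hz)
    rw [hfg z, norm_mul, mul_comm]
    gcongr
    rw [norm_prod, mul_comm S.card T, pow_mul, Finset.prod_congr rfl fun s _ => norm_pow _ _,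
      ← Finset.prod_const]
    exact Finset.prod_le_prod (fun _ _ => by positivity)
      fun s hs => pow_le_pow_left₀ (by positivity) (hS z hz s hs) _
  have hgw : ‖g w‖ ≤ B / (2 * ρ) ^ (S.card * T) :=
    Complex.norm_le_of_forall_mem_frontier_norm_le Metric.isBounded_ball hg.diffContOnCl hgB
      (by rwa [closure_ball _ hR.ne', mem_closedBall_zero_iff])
  have hfw : ‖f w‖ ≤ ρ ^ (S.card * T) * ‖g w‖ := by
    rw [hfg w, norm_mul]
    gcongr
    rw [norm_prod, mul_comm S.card T, pow_mul, Finset.prod_congr rfl fun s _ => norm_pow _ _,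
      ← Finset.prod_const]
    exact Finset.prod_le_prod (fun _ _ => by positivity)
      fun s hs => pow_le_pow_left₀ (norm_nonneg _) (hwS s hs) _
  calc ‖f w‖ * 2 ^ (S.card * T) ≤ (ρ ^ (S.card * T) * ‖g w‖) * 2 ^ (S.card * T) := by gcongr
    _ = ‖g w‖ * (2 * ρ) ^ (S.card * T) := by rw [mul_pow]; ring
    _ ≤ B := (le_div_iff₀ (by positivity)).mp hgw

/-- If the derivative of each member of a family indexed by multi-indices is a combination of the
members with the next higher multi-indices, vanishing of the family yields zeros of high order. -/
theorem iteratedDeriv_eq_zero_of_family {ι : Type*} [Fintype ι] [DecidableEq ι]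
    (φ : (ι → ℕ) → ℂ → ℂ) (u : ι → ℂ)
    (hφ : ∀ m z, HasDerivAt (φ m) (∑ i, u i * φ (m + Pi.single i 1) z) z) {N : ℕ} {l : ℂ}
    (h : ∀ m : ι → ℕ, ∑ i, m i < N → φ m l = 0) (k : ℕ) :
    ∀ m : ι → ℕ, ∑ i, m i + k < N → iteratedDeriv k (φ m) l = 0 := by
  have hdiff : ∀ m, Differentiable ℂ (φ m) := fun m z => (hφ m z).differentiableAt
  induction k with
  | zero => intro m hm; simpa using h m (by simpa using hm)
  | succ k ih =>
    intro m hm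
    have hderiv : deriv (φ m) = fun z => ∑ i, u i * φ (m + Pi.single i 1) z :=
      funext fun z => (hφ m z).deriv
    rw [iteratedDeriv_succ', hderiv, iteratedDeriv_fun_sum]
    · refine Finset.sum_eq_zero fun i _ => ?_
      rw [iteratedDeriv_const_mul_field, ih, mul_zero]
      have : ∑ j, (m + Pi.single i 1 : ι → ℕ) j = ∑ j, m j + 1 := by
        simp [Finset.sum_add_distrib]
      omega
    · intro i _
      exact ((hdiff _).const_mul _).contDiff.contDiffAt

section NumberFieldBounds

open NumberField

/-- Siegel's lemma over the ring of integers, when there are at least twice as many unknowns as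
equations. -/
theorem exists_siegel_house_bound (K : Type*) [Field K] [NumberField K] :
    ∃ C : ℝ, 1 ≤ C ∧ ∀ (α β : Type) [Fintype α] [Fintype β] (a : Matrix α β (𝓞 K)) (A : ℝ),
      1 ≤ A → 0 < Fintype.card α → 2 * Fintype.card α ≤ Fintype.card β →
      (∀ k l, house (a k l : K) ≤ A) →
      ∃ ξ : β → 𝓞 K, ξ ≠ 0 ∧ a.mulVec ξ = 0 ∧
        ∀ l, house (ξ l : K) ≤ C * (Fintype.card β * A) := by
  classical
  obtain ⟨c, hc⟩ : ∃ c : ℝ, ∀ (α β : Type) [Fintype α] [Fintype β] (a : Matrix α β (𝓞 K)) (A : ℝ),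
      a ≠ 0 → 0 < Fintype.card α → Fintype.card α < Fintype.card β →
      (∀ k l, house (a k l : K) ≤ A) →
      ∃ ξ : β → 𝓞 K, ξ ≠ 0 ∧ a.mulVec ξ = 0 ∧ ∀ l, house (ξ l : K) ≤
        c * (c * Fintype.card β * A) ^
          ((Fintype.card α : ℝ) / ((Fintype.card β : ℝ) - Fintype.card α)) :=
    ⟨_, fun α β _ _ a A ha hα hαβ hA =>
      house.exists_ne_zero_int_vec_house_le K a ha hα hαβ rfl hA rfl⟩
  refine ⟨max 1 |c| * max 1 |c|, ?_, ?_⟩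
  · nlinarith [le_max_left 1 |c|]
  intro α β _ _ a A hA1 hα hαβ hA
  have hC1 : 1 ≤ max 1 |c| := le_max_left _ _
  have hβ : (1 : ℝ) ≤ Fintype.card β := by exact_mod_cast (by omega : 1 ≤ Fintype.card β)
  have hβA : 1 ≤ Fintype.card β * A := one_le_mul_of_one_le_of_one_le hβ hA1
  by_cases ha : a = 0
  · have : Nonempty β := Fintype.card_pos_iff.mp (by omega)
    refine ⟨1, one_ne_zero, by simp [ha], fun l => ?_⟩
    have h1 : house (((1 : β → 𝓞 K) l : 𝓞 K) : K) = 1 := by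
      simpa using house_intCast (K := K) 1
    rw [h1]
    exact one_le_mul_of_one_le_of_one_le (one_le_mul_of_one_le_of_one_le hC1 hC1) hβA
  · obtain ⟨ξ, h0, hξ, hb⟩ := hc α β a A ha hα (by omega) hA
    refine ⟨ξ, h0, hξ, fun l => (hb l).trans ?_⟩
    set e : ℝ := (Fintype.card α : ℝ) / ((Fintype.card β : ℝ) - Fintype.card α) with he
    have hα' : (0 : ℝ) < Fintype.card α := by exact_mod_cast hα
    have hαβ' : 2 * (Fintype.card α : ℝ) ≤ Fintype.card β := by exact_mod_cast hαβ
    have he0 : 0 ≤ e := div_nonneg hα'.le (by linarith)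
    have he1 : e ≤ 1 := by
      rw [he, div_le_one (by linarith)]
      linarith
    have hle : |c * Fintype.card β * A| ≤ max 1 |c| * (Fintype.card β * A) := by
      rw [mul_assoc, abs_mul, abs_of_pos (by linarith : 0 < Fintype.card β * A)]
      gcongr
      exact le_max_right _ _
    calc c * (c * Fintype.card β * A) ^ e ≤ |c * (c * Fintype.card β * A) ^ e| := le_abs_self _
      _ = |c| * |(c * Fintype.card β * A) ^ e| := abs_mul _ _
      _ ≤ max 1 |c| * (max 1 |c| * (Fintype.card β * A)) := by
          gcongr
          · exact le_max_right _ _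
          calc |(c * Fintype.card β * A) ^ e| ≤ |c * Fintype.card β * A| ^ e :=
                Real.abs_rpow_le_abs_rpow _ _
            _ ≤ (max 1 |c| * (Fintype.card β * A)) ^ e :=
                Real.rpow_le_rpow (abs_nonneg _) hle he0
            _ ≤ (max 1 |c| * (Fintype.card β * A)) ^ (1 : ℝ) :=
                Real.rpow_le_rpow_of_exponent_le
                  (one_le_mul_of_one_le_of_one_le hC1 hβA) he1
            _ = _ := Real.rpow_one _
      _ = _ := by ring

/-- Liouville's inequality for algebraic integers. -/
theorem one_le_norm_mul_pow_of_ne_zero {K : Type*} [Field K] [NumberField K] {x : 𝓞 K}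
    (hx : x ≠ 0) (σ : K →+* ℂ) {H : ℝ} (hH : house (x : K) ≤ H) :
    1 ≤ ‖σ x‖ * H ^ (Module.finrank ℚ K - 1) := by
  have h1 : (1 : ℝ) ≤ ‖Algebra.norm ℚ (x : K)‖ := by
    have hn : Algebra.norm ℤ x ≠ 0 := Algebra.norm_ne_zero_iff.mpr hx
    rw [← Algebra.coe_norm_int x, ← Rat.norm_cast_real]
    simpa using (by exact_mod_cast Int.one_le_abs hn : (1 : ℝ) ≤ |((Algebra.norm ℤ x : ℤ) : ℝ)|)
  refine (h1.trans (norm_norm_le_norm_mul_house_pow (x : K) σ)).trans ?_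
  gcongr
  exact house_nonneg _

theorem house_le_of_forall_norm_le {K : Type*} [Field K] [NumberField K] (x : K) {H : ℝ}
    (hH : 0 ≤ H) (h : ∀ σ : K →+* ℂ, ‖σ x‖ ≤ H) : house x ≤ H :=
  (pi_norm_le_iff_of_nonneg hH).mpr h

end NumberFieldBounds

/-- The value at the integer `l`, in algebraic form, of the `m`-th mixed derivative of the
monomial with exponents `j`. -/
noncomputable def auxEntry {R ι : Type*} [CommRing R] [Fintype ι] {D E : ℕ} (a b : ι → R)
    (m : ι → ℕ) (l : ℕ) (j : Fin D × (ι → Fin E)) : R :=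
  (∏ i, a i ^ (j.2 i : ℕ)) ^ l *
    (symbolAct (derivSymbol b (fun i => (j.2 i : ℕ)) m) j.1).eval (l : R)

/-- The restriction to the line spanned by `u` of the `m`-th mixed derivative of the auxiliary
function `∑ p (d, x) * (b · z) ^ d * exp (x · z)`. -/
noncomputable def auxFun {ι : Type*} [Fintype ι] [DecidableEq ι] {D E : ℕ} (u b : ι → ℂ)
    (p : Fin D × (ι → Fin E) → ℂ) (m : ι → ℕ) (z : ℂ) : ℂ :=
  ∑ j, p j * (Complex.exp (z * ∑ i, (j.2 i : ℕ) * u i) *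
    (symbolAct (derivSymbol b (fun i => (j.2 i : ℕ)) m) j.1).eval z)

section Auxiliary

variable {ι : Type*} [Fintype ι] {D E : ℕ}

theorem map_auxEntry {R S : Type*} [CommRing R] [CommRing S] (f : R →+* S) (a b : ι → R)
    (m : ι → ℕ) (l : ℕ) (j : Fin D × (ι → Fin E)) :
    f (auxEntry a b m l j) = auxEntry (fun i => f (a i)) (fun i => f (b i)) m l j := by
  rw [auxEntry, auxEntry, ← derivSymbol_map f, ← symbolAct_map f, map_mul, map_pow, map_prod,
    ← map_natCast f l, Polynomial.eval_map_apply]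
  simp

theorem auxFun_natCast [DecidableEq ι] {u a : ι → ℂ} (hua : ∀ i, Complex.exp (u i) = a i)
    (b : ι → ℂ) (p : Fin D × (ι → Fin E) → ℂ) (m : ι → ℕ) (l : ℕ) :
    auxFun u b p m l = ∑ j, p j * auxEntry a b m l j := by
  refine Finset.sum_congr rfl fun j _ => ?_
  rw [auxEntry, Complex.exp_nat_mul, Complex.exp_sum]
  simp_rw [Complex.exp_nat_mul, hua]

theorem hasDerivAt_auxFun [DecidableEq ι] {u b : ι → ℂ} (hub : ∑ i, b i * u i = 1)
    (p : Fin D × (ι → Fin E) → ℂ) (m : ι → ℕ) (z : ℂ) :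
    HasDerivAt (auxFun u b p m) (∑ i, u i * auxFun u b p (m + Pi.single i 1) z) z := by
  simp only [auxFun, Finset.mul_sum]
  rw [Finset.sum_comm]
  refine HasDerivAt.fun_sum fun j _ => ?_
  set c : ℂ := ∑ i, (j.2 i : ℕ) * u i with hc
  set P := derivSymbol b (fun i => (j.2 i : ℕ)) m with hP
  have hexp : HasDerivAt (fun z : ℂ => Complex.exp (z * c)) (Complex.exp (z * c) * c) z := by
    simpa using ((hasDerivAt_id z).mul_const c).cexp
  have hpoly := (symbolAct P j.1).hasDerivAt z
  rw [derivative_symbolAct] at hpoly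
  have hstep : ∀ i, (symbolAct (derivSymbol b (fun i => (j.2 i : ℕ)) (m + Pi.single i 1))
      j.1).eval z = b i * (symbolAct (Polynomial.X * P) j.1).eval z +
        (j.2 i : ℕ) * (symbolAct P j.1).eval z := by
    intro i
    rw [derivSymbol_add_single, add_mul, mul_assoc, symbolAct_add, symbolAct_C_mul,
      symbolAct_C_mul]
    simp [hP]
  refine ((hexp.fun_mul hpoly).const_mul (p j)).congr_deriv (Eq.symm ?_)
  calc _ = ∑ i, (p j * Complex.exp (z * c) * (symbolAct (Polynomial.X * P) j.1).eval z *
          (b i * u i) +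
          p j * Complex.exp (z * c) * (symbolAct P j.1).eval z * ((j.2 i : ℕ) * u i)) := by
        refine Finset.sum_congr rfl fun i _ => ?_
        rw [hstep i, ← Finset.mul_sum, ← hc]
        ring
    _ = _ := by
        rw [Finset.sum_add_distrib, ← Finset.mul_sum, ← Finset.mul_sum, hub, ← hc]
        ring

theorem norm_eval_symbolAct_derivSymbol_le {b : ι → ℂ} {B : ℝ} (hB : 1 ≤ B)
    (hb : ∀ i, ‖b i‖ ≤ B) {m : ι → ℕ} {M : ℕ} (hm : ∑ i, m i ≤ M) {r : ℕ} (hr : 1 ≤ r) {z : ℂ}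
    (hz : ‖z‖ ≤ r) (j : Fin D × (ι → Fin E)) :
    ‖(symbolAct (derivSymbol b (fun i => (j.2 i : ℕ)) m) j.1).eval z‖ ≤
      (B + E) ^ M * ((D : ℝ) + r) ^ D := by
  have hr' : (1 : ℝ) ≤ r := by exact_mod_cast hr
  have hD : (0 : ℝ) ≤ D := Nat.cast_nonneg D
  have hE : (0 : ℝ) ≤ E := Nat.cast_nonneg E
  have hcoeff := sum_norm_coeff_derivSymbol_le b (fun i => (j.2 i : ℕ)) m (A := B + E)
    (fun i => add_le_add (hb i) (by exact_mod_cast (j.2 i).2.le)) (j.1 + 1)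
  refine (norm_eval_symbolAct_le _ _ (D := D) (by exact_mod_cast j.1.2.le) hz hcoeff).trans ?_
  gcongr
  · linarith
  · linarith
  · exact j.1.2.le

theorem norm_auxEntry_le {a b : ι → ℂ} {B : ℝ} (hB : 1 ≤ B) (ha : ∀ i, ‖a i‖ ≤ B)
    (hb : ∀ i, ‖b i‖ ≤ B) {m : ι → ℕ} {M : ℕ} (hm : ∑ i, m i ≤ M) {r l : ℕ} (hr : 1 ≤ r)
    (hl : l ≤ r) (j : Fin D × (ι → Fin E)) :
    ‖auxEntry a b m l j‖ ≤
      B ^ (Fintype.card ι * E * r) * ((B + E) ^ M * ((D : ℝ) + r) ^ D) := by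
  rw [auxEntry, norm_mul]
  gcongr
  · have hprod : ‖∏ i, a i ^ (j.2 i : ℕ)‖ ≤ B ^ (Fintype.card ι * E) := by
      rw [norm_prod, mul_comm, pow_mul, ← Finset.card_univ, ← Finset.prod_const]
      refine Finset.prod_le_prod (fun _ _ => norm_nonneg _) fun i _ => ?_
      rw [norm_pow]
      exact (pow_le_pow_left₀ (norm_nonneg _) (ha i) _).trans
        (pow_le_pow_right₀ hB (j.2 i).2.le)
    rw [norm_pow, pow_mul]
    exact (pow_le_pow_left₀ (norm_nonneg _) hprod _).trans
      (pow_le_pow_right₀ (one_le_pow₀ hB) hl)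
  · exact norm_eval_symbolAct_derivSymbol_le hB hb hm hr
      (by simpa using (by exact_mod_cast hl : (l : ℝ) ≤ r)) j

theorem norm_auxFun_le [DecidableEq ι] {u b : ι → ℂ} {B : ℝ} (hB : 1 ≤ B)
    (hu : ∀ i, ‖u i‖ ≤ Real.log B) (hb : ∀ i, ‖b i‖ ≤ B) {m : ι → ℕ} {M : ℕ}
    (hm : ∑ i, m i ≤ M) {r : ℕ} (hr : 1 ≤ r) {z : ℂ} (hz : ‖z‖ ≤ r) {P : ℝ}
    {p : Fin D × (ι → Fin E) → ℂ} (hp : ∀ j, ‖p j‖ ≤ P) :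
    ‖auxFun u b p m z‖ ≤ (D * E ^ Fintype.card ι : ℕ) *
      (P * (B ^ (Fintype.card ι * E * r) * ((B + E) ^ M * ((D : ℝ) + r) ^ D))) := by
  have hcard : (Finset.univ : Finset (Fin D × (ι → Fin E))).card = D * E ^ Fintype.card ι := by
    simp
  rw [← hcard, ← nsmul_eq_mul]
  refine (norm_sum_le _ _).trans (Finset.sum_le_card_nsmul _ _ _ fun j _ => ?_)
  rw [norm_mul, norm_mul]
  have hP : 0 ≤ P := (norm_nonneg _).trans (hp j)
  gcongr
  · exact hp j
  · rw [Complex.norm_exp]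
    have hlog : 0 ≤ Real.log B := Real.log_nonneg hB
    have hsum : ‖∑ i, (j.2 i : ℕ) * u i‖ ≤ Fintype.card ι * (E * Real.log B) := by
      rw [← nsmul_eq_mul, ← Finset.card_univ]
      refine (norm_sum_le _ _).trans (Finset.sum_le_card_nsmul _ _ _ fun i _ => ?_)
      rw [norm_mul, Complex.norm_natCast]
      gcongr
      · exact (j.2 i).2.le
      · exact hu i
    have hre : (z * ∑ i, (j.2 i : ℕ) * u i).re ≤
        ((Fintype.card ι * E * r : ℕ) : ℝ) * Real.log B := by
      refine (Complex.re_le_norm _).trans ?_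
      rw [norm_mul]
      calc _ ≤ (r : ℝ) * (Fintype.card ι * (E * Real.log B)) := by gcongr
        _ = _ := by push_cast; ring
    refine (Real.exp_le_exp.mpr hre).trans ?_
    rw [Real.exp_nat_mul, Real.exp_log (by linarith)]
  · exact norm_eval_symbolAct_derivSymbol_le hB hb hm hr hz j

end Auxiliary

section LinearForms

open NumberField

variable {K : Type*} [Field K] [NumberField K] {ι : Type} [Fintype ι] [DecidableEq ι] {D E : ℕ}

theorem house_sum_auxEntry_le {a b : ι → 𝓞 K} {p : Fin D × (ι → Fin E) → 𝓞 K}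
    {B P : ℝ} (hB : 1 ≤ B) (ha : ∀ (σ : K →+* ℂ) i, ‖σ (a i)‖ ≤ B)
    (hb : ∀ (σ : K →+* ℂ) i, ‖σ (b i)‖ ≤ B) (hp : ∀ j, house (p j : K) ≤ P)
    {m : ι → ℕ} {M : ℕ} (hm : ∑ i, m i ≤ M) {r l : ℕ} (hr : 1 ≤ r) (hl : l ≤ r) :
    house ((∑ j, p j * auxEntry a b m l j : 𝓞 K) : K) ≤ (D * E ^ Fintype.card ι : ℕ) *
      (P * (B ^ (Fintype.card ι * E * r) * ((B + E) ^ M * ((D : ℝ) + r) ^ D))) := by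
  have hcard : (Finset.univ : Finset (Fin D × (ι → Fin E))).card = D * E ^ Fintype.card ι := by
    simp
  change house (algebraMap (𝓞 K) K _) ≤ _
  rw [map_sum]
  refine (house_sum_le_sum_house _ _).trans ?_
  rw [← hcard, ← nsmul_eq_mul]
  refine Finset.sum_le_card_nsmul _ _ _ fun j _ => ?_
  rw [map_mul]
  refine (house_mul_le _ _).trans ?_
  have hP : 0 ≤ P := (house_nonneg _).trans (hp j)
  gcongr
  · exact house_nonneg _
  · exact hp j
  · refine house_le_of_forall_norm_le _ (by positivity) fun σ => ?_
    have := map_auxEntry (σ.comp (algebraMap (𝓞 K) K)) a b m l j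
    rw [RingHom.comp_apply] at this
    rw [this]
    exact norm_auxEntry_le hB (ha σ) (hb σ) hm hr hl j

/-- Extrapolation: if the auxiliary function has zeros of order `2 * T` at the integers below `X`,
then it has zeros of order `T` at the integers below `Y`. -/
theorem sum_auxEntry_eq_zero_of_zeros (σ₀ : K →+* ℂ) {a b : ι → 𝓞 K} {u : ι → ℂ}
    (hua : ∀ i, Complex.exp (u i) = σ₀ (a i)) (hub : ∑ i, σ₀ (b i) * u i = 1)
    {p : Fin D × (ι → Fin E) → 𝓞 K} {B P : ℝ} (hB : 1 ≤ B)
    (ha : ∀ (σ : K →+* ℂ) i, ‖σ (a i)‖ ≤ B) (hb : ∀ (σ : K →+* ℂ) i, ‖σ (b i)‖ ≤ B)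
    (hu : ∀ i, ‖u i‖ ≤ Real.log B) (hp : ∀ j, house (p j : K) ≤ P) {M T X Y : ℕ}
    (hTM : T ≤ M) (hXY : X ≤ Y) (hY : 1 ≤ Y) {H : ℝ}
    (hH : (D * E ^ Fintype.card ι : ℕ) * (P * (B ^ (Fintype.card ι * E * (3 * Y)) *
      ((B + E) ^ M * ((D : ℝ) + (3 * Y : ℕ)) ^ D))) ≤ H)
    (hHT : H ^ Module.finrank ℚ K < 2 ^ (X * T))
    (hz : ∀ l < X, ∀ m : ι → ℕ, ∑ i, m i < 2 * T → ∑ j, p j * auxEntry a b m l j = 0) :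
    ∀ l < Y, ∀ m : ι → ℕ, ∑ i, m i < T → ∑ j, p j * auxEntry a b m l j = 0 := by
  intro l hl m hm
  by_contra hne
  set b' : ι → ℂ := fun i => σ₀ (b i) with hb'
  set p' : Fin D × (ι → Fin E) → ℂ := fun j => σ₀ (p j) with hp'
  have hval : ∀ (m : ι → ℕ) (l : ℕ),
      σ₀ ((∑ j, p j * auxEntry a b m l j : 𝓞 K) : K) = auxFun u b' p' m l := by
    intro m l
    change σ₀ (algebraMap (𝓞 K) K _) = _
    rw [auxFun_natCast hua, map_sum, map_sum]
    refine Finset.sum_congr rfl fun j _ => ?_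
    rw [map_mul, map_mul]
    congr 1
    exact map_auxEntry (σ₀.comp (algebraMap (𝓞 K) K)) a b m l j
  have hder := hasDerivAt_auxFun (D := D) (E := E) (b := b') hub p'
  have hdiff : Differentiable ℂ (auxFun u b' p' m) := fun z => (hder m z).differentiableAt
  have hbound : ∀ z : ℂ, ‖z‖ = (3 * Y : ℕ) → ‖auxFun u b' p' m z‖ ≤ H := fun z hz =>
    (norm_auxFun_le hB hu (hb σ₀) (hm.le.trans hTM) (by omega) hz.le
      (fun j => (norm_embedding_le_house _ σ₀).trans (hp j))).trans hH
  have hYpos : (0 : ℝ) < Y := by exact_mod_cast hY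
  have hschwarz := norm_mul_two_pow_le_of_zeros
    ((Finset.range X).image (fun k : ℕ => (k : ℂ))) T hdiff (by
      intro s hs
      obtain ⟨k, hk, rfl⟩ := Finset.mem_image.mp hs
      rw [natCast_le_analyticOrderAt_iff_iteratedDeriv_eq_zero (hdiff.analyticAt _)]
      intro i hi
      refine iteratedDeriv_eq_zero_of_family (auxFun u b' p') u hder (N := 2 * T) ?_ i m
        (by omega)
      intro m' hm'
      rw [← hval, hz k (Finset.mem_range.mp hk) m' hm']
      simp)
    (R := (3 * Y : ℕ)) (ρ := Y) (by exact_mod_cast (by omega : 0 < 3 * Y)) hYpos hbound (by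
      intro z hz s hs
      obtain ⟨k, hk, rfl⟩ := Finset.mem_image.mp hs
      have hkY : (k : ℝ) ≤ Y := by
        exact_mod_cast ((Finset.mem_range.mp hk).le.trans hXY)
      have := norm_sub_norm_le z (k : ℂ)
      rw [hz, Complex.norm_natCast] at this
      push_cast at this
      linarith) (w := (l : ℂ)) (by
      rw [Complex.norm_natCast]
      exact_mod_cast (by omega : l ≤ 3 * Y)) (by
      intro s hs
      obtain ⟨k, hk, rfl⟩ := Finset.mem_image.mp hs
      have hk' : k < Y := (Finset.mem_range.mp hk).trans_le hXY
      rw [show ((l : ℂ) - (k : ℂ)) = (((l : ℝ) - (k : ℝ) : ℝ) : ℂ) by push_cast; ring,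
        Complex.norm_real, Real.norm_eq_abs, abs_le]
      have h1 : (l : ℝ) ≤ Y := by exact_mod_cast hl.le
      have h2 : (k : ℝ) ≤ Y := by exact_mod_cast hk'.le
      have h3 : (0 : ℝ) ≤ l := Nat.cast_nonneg l
      have h4 : (0 : ℝ) ≤ k := Nat.cast_nonneg k
      constructor <;> linarith)
  rw [Finset.card_image_of_injective _ Nat.cast_injective, Finset.card_range] at hschwarz
  have hhouse : house ((∑ j, p j * auxEntry a b m l j : 𝓞 K) : K) ≤ H :=
    (house_sum_auxEntry_le hB ha hb hp (hm.le.trans hTM) (by omega)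
      (by omega : l ≤ 3 * Y)).trans hH
  have hliou := one_le_norm_mul_pow_of_ne_zero hne σ₀ hhouse
  rw [hval] at hliou
  have hH0 : 0 ≤ H := (house_nonneg _).trans hhouse
  have hfin : 0 < Module.finrank ℚ K := Module.finrank_pos
  have : (2 : ℝ) ^ (X * T) ≤ H ^ Module.finrank ℚ K := by
    calc (2 : ℝ) ^ (X * T)
        ≤ (‖auxFun u b' p' m l‖ * H ^ (Module.finrank ℚ K - 1)) * 2 ^ (X * T) :=
          le_mul_of_one_le_left (by positivity) hliou
      _ = (‖auxFun u b' p' m l‖ * 2 ^ (X * T)) * H ^ (Module.finrank ℚ K - 1) := by ring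
      _ ≤ H * H ^ (Module.finrank ℚ K - 1) := by gcongr
      _ = H ^ Module.finrank ℚ K := by
          rw [← pow_succ']
          congr 1
          omega
  exact absurd hHT (not_lt.mpr this)

end LinearForms

section Transcendence

open NumberField

theorem exists_mul_lt_two_pow (c k : ℕ) : ∃ τ, k ≤ τ ∧ c * τ < 2 ^ τ := by
  refine ⟨2 * (2 * c + k), by omega, ?_⟩
  set s := 2 * c + k with hs
  have h1 : s < 2 ^ s := Nat.lt_two_pow_self
  calc c * (2 * s) = (2 * c) * s := by ring
    _ ≤ s * s := by gcongr; omega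
    _ < 2 ^ s * 2 ^ s := Nat.mul_lt_mul'' h1 h1
    _ = 2 ^ (2 * s) := by rw [← pow_add, two_mul]

theorem growth_le_two_pow {n κ τ J E D r Y M : ℕ} (hκ : κ + 2 ≤ τ) (hE : E = 2 ^ (2 * n * τ))
    (hD : D = 2 ^ ((2 * n + 2) * τ)) (hr : r ≤ 3 * Y) (hY : Y ≤ 2 ^ (τ * (J + 1))) :
    ((2 : ℝ) ^ κ) ^ (n * E * r) * (((2 : ℝ) ^ κ + E) ^ M * ((D : ℝ) + r) ^ D) ≤
      2 ^ (κ * (n * E * (3 * Y)) + ((2 * n + 1) * τ * M + τ * (2 * n + J + 6) * D)) := by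
  have h1 : (2 : ℝ) ^ κ + E ≤ 2 ^ ((2 * n + 1) * τ) := by
    have e : (2 * n + 1) * τ = (2 * n + 1) * τ - 1 + 1 := by
      have : 0 < (2 * n + 1) * τ := Nat.mul_pos (by omega) (by omega)
      omega
    have a1 : (2 : ℝ) ^ κ ≤ 2 ^ ((2 * n + 1) * τ - 1) :=
      pow_le_pow_right₀ one_le_two (by
        have : τ ≤ (2 * n + 1) * τ := Nat.le_mul_of_pos_left _ (by omega)
        omega)
    have a2 : (E : ℝ) ≤ 2 ^ ((2 * n + 1) * τ - 1) := by
      rw [hE]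
      push_cast
      exact pow_le_pow_right₀ one_le_two (by
        have : (2 * n + 1) * τ = 2 * n * τ + τ := by ring
        omega)
    rw [e, pow_succ]
    linarith
  have h2 : (D : ℝ) + r ≤ 2 ^ (τ * (2 * n + J + 6)) := by
    have e : τ * (2 * n + J + 6) = (2 * n + 2) * τ + τ * (J + 1) + 3 * τ := by ring
    have a1 : D ≤ 2 ^ (τ * (2 * n + J + 6) - 1) := by
      rw [hD]
      exact Nat.pow_le_pow_right two_pos (by omega)
    have a2 : r ≤ 2 ^ (τ * (2 * n + J + 6) - 1) := by
      calc r ≤ 2 ^ 2 * 2 ^ (τ * (J + 1)) := by omega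
        _ = 2 ^ (2 + τ * (J + 1)) := (pow_add _ _ _).symm
        _ ≤ _ := Nat.pow_le_pow_right two_pos (by omega)
    have e' : τ * (2 * n + J + 6) = τ * (2 * n + J + 6) - 1 + 1 := by omega
    have : D + r ≤ 2 ^ (τ * (2 * n + J + 6)) := by
      rw [e', pow_succ]
      omega
    exact_mod_cast this
  rw [pow_add, pow_add, pow_mul _ κ, pow_mul _ _ M, pow_mul _ _ D]
  gcongr
  exact one_le_pow₀ one_le_two

theorem exponent_lt {n κ τ δ J j E t X D T : ℕ} (hτ : 1 ≤ τ) (hE : 1 ≤ E) (ht : t = 2 ^ τ)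
    (hX : t ≤ X) (hD : D = t * t * E) (hT : T * 2 ^ (j + 1) = D) (hj : j + 1 ≤ J)
    (hc : δ * (2 * J + κ + 6 * κ * n + 2 * (2 * n + 1) * (n + 1) + 2 * (2 * n + J + 6)) * 2 ^ J
      * τ < 2 ^ τ) :
    (2 * (τ * J) + κ + 2 * (κ * (n * E * (3 * (t * X))) + ((2 * n + 1) * τ * ((n + 1) * D) +
      τ * (2 * n + J + 6) * D))) * δ < X * T := by
  set G := E * t * X with hG
  have ht1 : 1 ≤ t := ht ▸ Nat.one_le_two_pow
  have hG1 : 1 ≤ G := Nat.mul_pos (Nat.mul_pos hE ht1) (ht1.trans hX)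
  have hDG : D ≤ G := by
    calc D = E * t * t := by rw [hD]; ring
      _ ≤ _ := Nat.mul_le_mul_left _ hX
  have hτG : τ ≤ τ * G := Nat.le_mul_of_pos_right _ hG1
  have hκ : κ ≤ κ * (τ * G) := Nat.le_mul_of_pos_right _ (Nat.mul_pos hτ hG1)
  have hG' : G ≤ τ * G := Nat.le_mul_of_pos_left _ hτ
  have hbound : (2 * (τ * J) + κ + 2 * (κ * (n * E * (3 * (t * X))) +
      ((2 * n + 1) * τ * ((n + 1) * D) + τ * (2 * n + J + 6) * D))) * δ ≤
      δ * (2 * J + κ + 6 * κ * n + 2 * (2 * n + 1) * (n + 1) + 2 * (2 * n + J + 6)) * τ * G := by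
    calc _ = (2 * (τ * J) + κ + 2 * (κ * n * 3 * G + ((2 * n + 1) * τ * ((n + 1) * D) +
          τ * (2 * n + J + 6) * D))) * δ := by rw [hG]; ring
      _ ≤ (2 * (τ * G * J) + κ * (τ * G) + 2 * (κ * n * 3 * (τ * G) +
          ((2 * n + 1) * τ * ((n + 1) * G) + τ * (2 * n + J + 6) * G))) * δ := by gcongr
      _ = _ := by ring
  refine lt_of_mul_lt_mul_right (a := 2 ^ (j + 1)) ?_ (Nat.zero_le _)
  calc _ ≤ δ * (2 * J + κ + 6 * κ * n + 2 * (2 * n + 1) * (n + 1) + 2 * (2 * n + J + 6)) * τ * G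
        * 2 ^ J := Nat.mul_le_mul hbound (Nat.pow_le_pow_right two_pos hj)
    _ = δ * (2 * J + κ + 6 * κ * n + 2 * (2 * n + 1) * (n + 1) + 2 * (2 * n + J + 6)) * 2 ^ J
        * τ * G := by ring
    _ < 2 ^ τ * G := Nat.mul_lt_mul_of_pos_right hc hG1
    _ = X * T * 2 ^ (j + 1) := by rw [mul_assoc, hT, hD, hG, ← ht]; ring

/-- A linear form with algebraic integer coefficients in logarithms of algebraic integers is
never equal to `1`. -/
theorem linearForm_log_ne_one {K : Type*} [Field K] [NumberField K] (σ₀ : K →+* ℂ) {ι : Type}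
    [Fintype ι] [DecidableEq ι] {a b : ι → 𝓞 K} {u : ι → ℂ}
    (hua : ∀ i, Complex.exp (u i) = σ₀ (a i)) : ∑ i, σ₀ (b i) * u i ≠ 1 := by
  intro hub
  obtain ⟨C, hC1, hsiegel⟩ := exists_siegel_house_bound K
  set n := Fintype.card ι with hn
  set δ := Module.finrank ℚ K with hδ
  set J := 2 * n ^ 2 + 2 * n + 2 with hJ
  obtain ⟨κ, hκC, hκa, hκb, hκu⟩ : ∃ κ : ℕ, C ≤ 2 ^ κ ∧
      (∀ (σ : K →+* ℂ) i, ‖σ (a i)‖ ≤ 2 ^ κ) ∧ (∀ (σ : K →+* ℂ) i, ‖σ (b i)‖ ≤ 2 ^ κ) ∧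
      ∀ i, ‖u i‖ ≤ Real.log (2 ^ κ) := by
    have hlarge : ∀ c : ℝ, ∀ᶠ κ : ℕ in Filter.atTop, c ≤ 2 ^ κ := fun c =>
      (tendsto_pow_atTop_atTop_of_one_lt one_lt_two).eventually_ge_atTop c
    have h := ((hlarge C).and ((Filter.eventually_all.mpr fun σ : K →+* ℂ =>
      Filter.eventually_all.mpr fun i => hlarge ‖σ (a i)‖).and
      ((Filter.eventually_all.mpr fun σ : K →+* ℂ =>
      Filter.eventually_all.mpr fun i => hlarge ‖σ (b i)‖).and
      (Filter.eventually_all.mpr fun i => hlarge (Real.exp ‖u i‖))))).exists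
    obtain ⟨κ, h1, h2, h3, h4⟩ := h
    exact ⟨κ, h1, h2, h3, fun i => (Real.le_log_iff_exp_le (by positivity)).mpr (h4 i)⟩
  have hB1 : (1 : ℝ) ≤ 2 ^ κ := one_le_pow₀ one_le_two
  obtain ⟨τ, hτ, hcτ⟩ := exists_mul_lt_two_pow
    ((δ * (2 * J + κ + 6 * κ * n + 2 * (2 * n + 1) * (n + 1) + 2 * (2 * n + J + 6)) + (n + 1))
      * 2 ^ J) (κ + 2 + J)
  have hτ1 : 1 ≤ τ := by omega
  obtain ⟨t, ht⟩ : ∃ t, t = 2 ^ τ := ⟨_, rfl⟩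
  obtain ⟨E, hE⟩ : ∃ E, E = 2 ^ (2 * n * τ) := ⟨_, rfl⟩
  obtain ⟨D, hD⟩ : ∃ D, D = 2 ^ ((2 * n + 2) * τ) := ⟨_, rfl⟩
  have ht1 : 1 ≤ t := ht ▸ Nat.one_le_two_pow
  have hE1 : 1 ≤ E := hE ▸ Nat.one_le_two_pow
  have hDtE : D = t * t * E := by
    rw [hD, ht, hE, ← pow_add, ← pow_add]
    ring_nf
  have hQ : D * E ^ n = 2 ^ (τ * J) := by
    rw [hD, hE, ← pow_mul, ← pow_add, hJ]
    ring_nf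
  -- the auxiliary polynomial
  have hgrow : ∀ {r Y : ℕ}, r ≤ 3 * Y → Y ≤ 2 ^ (τ * (J + 1)) →
      ((2 : ℝ) ^ κ) ^ (n * E * r) * (((2 : ℝ) ^ κ + E) ^ ((n + 1) * D) * ((D : ℝ) + r) ^ D) ≤
      2 ^ (κ * (n * E * (3 * Y)) + ((2 * n + 1) * τ * ((n + 1) * D) +
        τ * (2 * n + J + 6) * D)) := fun hr hY =>
    growth_le_two_pow (by omega) hE hD hr hY
  set A : ℝ := ((2 : ℝ) ^ κ) ^ (n * E * t) *
    (((2 : ℝ) ^ κ + E) ^ ((n + 1) * D) * ((D : ℝ) + t) ^ D) with hA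
  have hA1 : 1 ≤ A := by
    have h1 : (1 : ℝ) ≤ 2 ^ κ + E := hB1.trans (by simp)
    have h2 : (1 : ℝ) ≤ D + t := by exact_mod_cast (by omega : 1 ≤ D + t)
    exact one_le_mul_of_one_le_of_one_le (one_le_pow₀ hB1)
      (one_le_mul_of_one_le_of_one_le (one_le_pow₀ h1) (one_le_pow₀ h2))
  obtain ⟨p, hp0, hpz, hpb⟩ := hsiegel (Fin t × (ι → Fin D)) (Fin D × (ι → Fin E))
    (fun x j => auxEntry a b (fun i => (x.2 i : ℕ)) x.1 j) A hA1
    (by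
      simp only [Fintype.card_prod, Fintype.card_fin, Fintype.card_pi, Finset.prod_const,
        Finset.card_univ]
      exact Nat.mul_pos ht1 (pow_pos (hD ▸ Nat.two_pow_pos _) _))
    (by
      simp only [Fintype.card_prod, Fintype.card_fin, Fintype.card_pi, Finset.prod_const,
        Finset.card_univ]
      rw [← hn, hQ, ht, hD, ← pow_mul, ← pow_add, ← pow_succ']
      refine Nat.pow_le_pow_right two_pos ?_
      rw [hJ]
      nlinarith)
    (fun x j => by
      refine house_le_of_forall_norm_le _ (by linarith) fun σ => ?_
      have := map_auxEntry (σ.comp (algebraMap (𝓞 K) K)) a b (fun i => (x.2 i : ℕ)) x.1 j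
      rw [RingHom.comp_apply] at this
      rw [this]
      refine norm_auxEntry_le hB1 (hκa σ) (hκb σ) ?_ ht1 x.1.2.le j
      calc ∑ i, (x.2 i : ℕ) ≤ ∑ _i : ι, D := Finset.sum_le_sum fun i _ => (x.2 i).2.le
        _ = n * D := by simp [hn]
        _ ≤ (n + 1) * D := Nat.mul_le_mul_right _ (by omega))
  have hcard : Fintype.card (Fin D × (ι → Fin E)) = D * E ^ n := by simp [hn]
  rw [hcard] at hpb
  -- extrapolation
  have hind : ∀ j ≤ J, ∀ l < t ^ (j + 1), ∀ m : ι → ℕ,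
      ∑ i, m i < 2 ^ ((2 * n + 2) * τ - j) → ∑ x, p x * auxEntry a b m l x = 0 := by
    have hJτ : J ≤ (2 * n + 2) * τ := by nlinarith
    intro j
    induction j with
    | zero =>
      intro _ l hl m hm
      rw [zero_add, pow_one] at hl
      rw [Nat.sub_zero, ← hD] at hm
      have := congrFun hpz (⟨l, hl⟩, fun i => ⟨m i,
        (Finset.single_le_sum (fun _ _ => Nat.zero_le _) (Finset.mem_univ i)).trans_lt hm⟩)
      refine Eq.trans (Finset.sum_congr rfl fun x _ => ?_) this
      exact mul_comm _ _
    | succ j ih =>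
      intro hj
      have hsub : 2 * 2 ^ ((2 * n + 2) * τ - (j + 1)) = 2 ^ ((2 * n + 2) * τ - j) := by
        rw [← pow_succ']
        congr 1
        omega
      have hT : 2 ^ ((2 * n + 2) * τ - (j + 1)) * 2 ^ (j + 1) = D := by
        rw [hD, ← pow_add]
        congr 1
        omega
      have hY : t ^ (j + 1 + 1) ≤ 2 ^ (τ * (J + 1)) := by
        rw [ht, ← pow_mul]
        exact Nat.pow_le_pow_right two_pos (Nat.mul_le_mul_left _ (by omega))
      have htX : t ≤ t ^ (j + 1) := Nat.le_self_pow (by omega) t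
      have htY : t ^ (j + 1) ≤ t ^ (j + 1 + 1) := Nat.pow_le_pow_right ht1 (by omega)
      refine sum_auxEntry_eq_zero_of_zeros σ₀ hua hub hB1 hκa hκb hκu hpb
        (M := (n + 1) * D) (X := t ^ (j + 1)) (Y := t ^ (j + 1 + 1))
        (H := 2 ^ (2 * (τ * J) + κ + 2 * (κ * (n * E * (3 * (t * t ^ (j + 1)))) +
          ((2 * n + 1) * τ * ((n + 1) * D) + τ * (2 * n + J + 6) * D)))) ?_ htY
        (Nat.one_le_pow _ _ ht1) ?_ ?_ ?_
      · calc _ ≤ 2 ^ ((2 * n + 2) * τ) := Nat.pow_le_pow_right two_pos (Nat.sub_le _ _)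
          _ = 1 * D := by rw [one_mul, hD]
          _ ≤ _ := Nat.mul_le_mul_right _ (by omega)
      · have h1 := hgrow (by omega : t ≤ 3 * t ^ (j + 1 + 1)) hY
        have h2 := hgrow le_rfl hY
        rw [← hA] at h1
        rw [← hn, hQ, ← pow_succ']
        set W := κ * (n * E * (3 * t ^ (j + 1 + 1))) + ((2 * n + 1) * τ * ((n + 1) * D) +
          τ * (2 * n + J + 6) * D) with hW
        calc _ ≤ ((2 ^ (τ * J) : ℕ) : ℝ) * (2 ^ κ * ((2 ^ (τ * J) : ℕ) * 2 ^ W) * 2 ^ W) := by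
              gcongr
          _ = _ := by
              push_cast
              ring
      · rw [← pow_mul]
        refine pow_lt_pow_right₀ one_lt_two ?_
        refine exponent_lt hτ1 hE1 ht htX hDtE hT hj (lt_of_le_of_lt ?_ hcτ)
        gcongr
        exact Nat.le_add_right _ _
      · rw [hsub]
        exact ih (by omega)
  -- conclusion
  have hp' : (fun j => σ₀ (p j)) = 0 := by
    refine auxiliary_coeff_eq_zero (N := t ^ (J + 1)) ?_ (fun i => σ₀ (b i))
      (fun x => ∏ i, σ₀ (a i) ^ (x i : ℕ)) ?_ _ ?_
    · rw [← hn, hQ, ht, ← pow_mul]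
      exact Nat.pow_le_pow_right two_pos (Nat.mul_le_mul_left _ (by omega))
    · intro x
      refine Finset.prod_ne_zero_iff.mpr fun i _ => pow_ne_zero _ ?_
      rw [← hua]
      exact Complex.exp_ne_zero _
    · intro l hl m hm
      have hsum : ∑ i, m i < 2 ^ ((2 * n + 2) * τ - J) := by
        have h1 : ∑ i, m i ≤ n * E := by
          calc ∑ i, m i ≤ ∑ _i : ι, E := Finset.sum_le_sum fun i _ => (hm i).le
            _ = n * E := by simp [hn]
        have h2 : (n + 1) * E < 2 ^ τ * E := by
          refine Nat.mul_lt_mul_of_pos_right (lt_of_le_of_lt ?_ hcτ) hE1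
          have h3 : 1 ≤ 2 ^ J := Nat.one_le_two_pow
          calc n + 1 = (n + 1) * 1 * 1 := by ring
            _ ≤ _ := Nat.mul_le_mul (Nat.mul_le_mul (Nat.le_add_left _ _) h3) hτ1
        have h4 : 2 ^ τ * E ≤ 2 ^ ((2 * n + 2) * τ - J) := by
          rw [hE, ← pow_add]
          refine Nat.pow_le_pow_right two_pos ?_
          have : (2 * n + 2) * τ = 2 * n * τ + 2 * τ := by ring
          omega
        have h5 : n * E ≤ (n + 1) * E := Nat.mul_le_mul_right _ (by omega)
        omega
      have h := congrArg (σ₀.comp (algebraMap (𝓞 K) K)) (hind J le_rfl l hl m hsum)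
      rw [map_zero, map_sum] at h
      rw [← h]
      refine Finset.sum_congr rfl fun j _ => ?_
      rw [map_mul, map_auxEntry]
      rfl
  refine hp0 (funext fun j => ?_)
  have := congrFun hp' j
  simpa using this

end Transcendence

section LogarithmicForms

open Filter Topology

theorem transcendental_sum_mul_log {ι : Type} [Fintype ι] {c v : ι → ℂ}
    (hc : ∀ i, IsAlgebraic ℚ (c i)) (hv : ∀ i, IsIntegral ℤ (Complex.exp (v i)))
    (h0 : ∑ i, c i * v i ≠ 0) : Transcendental ℚ (∑ i, c i * v i) := by
  classical
  intro halg
  set V := ∑ i, c i * v i with hV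
  have hdiv : ∀ i, IsAlgebraic ℤ (c i / V) := fun i =>
    (IsFractionRing.isAlgebraic_iff ℤ ℚ ℂ).mpr (by
      rw [div_eq_mul_inv]
      exact (hc i).mul halg.inv)
  choose y hy0 hy using fun i => (hdiv i).exists_integral_multiple
  obtain ⟨N, hN⟩ : ∃ N : ℕ, N = (∏ i, y i).natAbs := ⟨_, rfl⟩
  have hN0 : N ≠ 0 := by
    rw [hN, Int.natAbs_ne_zero]
    exact Finset.prod_ne_zero_iff.mpr fun i _ => hy0 i
  have hNC : (N : ℂ) ≠ 0 := Nat.cast_ne_zero.mpr hN0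
  have hb : ∀ i, IsIntegral ℤ ((N : ℂ) * (c i / V)) := by
    intro i
    obtain ⟨z, hz⟩ : y i ∣ (N : ℤ) := by
      rw [hN, Int.dvd_natAbs]
      exact Finset.dvd_prod_of_mem y (Finset.mem_univ i)
    have : (N : ℂ) = (z : ℂ) * (y i : ℂ) := by
      rw [← Int.cast_natCast, hz]
      push_cast
      ring
    rw [this, mul_assoc]
    refine (isIntegral_algebraMap (R := ℤ) (x := z)).mul ?_
    simpa using hy i
  have ha : ∀ i, IsIntegral ℤ (Complex.exp (v i / N)) := by
    intro i
    refine IsIntegral.of_pow (Nat.pos_of_ne_zero hN0) ?_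
    rw [← Complex.exp_nat_mul, mul_div_cancel₀ _ hNC]
    exact hv i
  set S : Set ℂ := Set.range (fun i => Complex.exp (v i / N)) ∪
    Set.range (fun i => (N : ℂ) * (c i / V)) with hS
  have hSfin : Finite S := ((Set.finite_range _).union (Set.finite_range _)).to_subtype
  let K := IntermediateField.adjoin ℚ S
  have hKfin : FiniteDimensional ℚ K := IntermediateField.finiteDimensional_adjoin (by
    rintro x (⟨i, rfl⟩ | ⟨i, rfl⟩)
    · exact (ha i).tower_top
    · exact (hb i).tower_top)
  have : NumberField K := ⟨⟩
  have hlift : ∀ x : ℂ, IsIntegral ℤ x → x ∈ K →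
      ∃ z : NumberField.RingOfIntegers K, algebraMap K ℂ z = x := by
    intro x hx hxK
    refine ⟨⟨⟨x, hxK⟩, ?_⟩, rfl⟩
    exact (isIntegral_algebraMap_iff (A := K) (B := ℂ) (algebraMap K ℂ).injective).mp hx
  choose a ha' using fun i => hlift _ (ha i)
    (IntermediateField.subset_adjoin ℚ S (Or.inl ⟨i, rfl⟩))
  choose b hb' using fun i => hlift _ (hb i)
    (IntermediateField.subset_adjoin ℚ S (Or.inr ⟨i, rfl⟩))
  refine linearForm_log_ne_one (algebraMap K ℂ) (a := a) (b := b) (u := fun i => v i / N)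
    (fun i => (ha' i).symm) ?_
  calc ∑ i, algebraMap K ℂ (b i) * (v i / N) = ∑ i, (c i * v i) * V⁻¹ := by
        refine Finset.sum_congr rfl fun i _ => ?_
        rw [hb']
        field_simp
    _ = 1 := by rw [← Finset.sum_mul, ← hV, mul_inv_cancel₀ h0]

theorem tendsto_sum_pow_div_neg_log {w : ℂ} (hw : ‖w‖ = 1) (hw1 : w ≠ 1) :
    Tendsto (fun N => ∑ i ∈ Finset.range N, w ^ (i + 1) / ((i : ℂ) + 1)) atTop
      (𝓝 (-Complex.log (1 - w))) := by
  have hcauchy : CauchySeq fun N => ∑ i ∈ Finset.range N, w ^ (i + 1) / ((i : ℂ) + 1) := by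
    have := Antitone.cauchySeq_series_mul_of_tendsto_zero_of_bounded
      (f := fun i : ℕ => 1 / ((i : ℝ) + 1)) (z := fun i => w ^ (i + 1)) (b := 2 / ‖w - 1‖)
      (fun i j hij => by
        have : (i : ℝ) ≤ j := by exact_mod_cast hij
        dsimp only
        gcongr) tendsto_one_div_add_atTop_nhds_zero_nat
      (fun n => by
        simp_rw [pow_succ]
        rw [← Finset.sum_mul, geom_sum_eq hw1, norm_mul, hw, mul_one, norm_div]
        gcongr
        refine (norm_sub_le _ _).trans ?_
        rw [norm_pow, hw]
        norm_num)
    convert this using 4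
    rw [Complex.real_smul]
    push_cast
    ring
  obtain ⟨s, hs⟩ := cauchySeq_tendsto_of_complete hcauchy
  have habel := Complex.tendsto_tsum_powerSeries_nhdsWithin_lt hs
  rw [tendsto_map'_iff] at habel
  have hre : 0 < (1 - w).re := by
    have h1 : w.re ≤ 1 := hw ▸ Complex.re_le_norm w
    refine lt_of_le_of_ne (by simpa using h1) fun h => hw1 ?_
    have h2 : w.re = 1 := by simp at h; linarith
    have h3 : w.im = 0 := by
      have := Complex.sq_norm w
      rw [Complex.normSq_apply, hw, h2] at this
      nlinarith
    exact Complex.ext h2 h3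
  have hid : Tendsto (fun x : ℝ => (x : ℂ)) (𝓝[<] 1) (𝓝 1) :=
    (Complex.continuous_ofReal.tendsto' 1 1 (by simp)).mono_left nhdsWithin_le_nhds
  have hlog : Tendsto (fun x : ℝ => -Complex.log (1 - w * (x : ℂ))) (𝓝[<] 1)
      (𝓝 (-Complex.log (1 - w))) := by
    refine Tendsto.neg (Tendsto.clog ?_ (Or.inl hre))
    simpa using (tendsto_const_nhds (x := (1 : ℂ))).sub (hid.const_mul w)
  have hmul := hid.mul habel
  rw [one_mul] at hmul
  have heq : (fun x : ℝ => -Complex.log (1 - w * (x : ℂ))) =ᶠ[𝓝[<] 1]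
      fun x : ℝ => (x : ℂ) * ((fun z => ∑' n : ℕ, w ^ (n + 1) / ((n : ℂ) + 1) * z ^ n) ∘
        Complex.ofReal) x := by
    filter_upwards [Ioo_mem_nhdsLT (zero_lt_one' ℝ)] with x hx
    have hx1 : ‖w * (x : ℂ)‖ < 1 := by
      rw [norm_mul, hw, one_mul, Complex.norm_real, Real.norm_eq_abs, abs_of_pos hx.1]
      exact hx.2
    rw [← (Complex.hasSum_taylorSeries_neg_log' hx1).tsum_eq, Function.comp_apply,
      ← tsum_mul_left]
    refine tsum_congr fun n => ?_
    rw [mul_pow]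
    ring
  rwa [tendsto_nhds_unique hlog (hmul.congr' heq.symm)]

theorem sum_range_pow_mul_primitiveRoot {q : ℕ} {ζ : ℂ} (hζ : IsPrimitiveRoot ζ q) (m : ℕ) :
    ∑ k ∈ Finset.range q, (ζ ^ k) ^ m = if q ∣ m then (q : ℂ) else 0 := by
  simp_rw [← pow_mul, mul_comm _ m, pow_mul]
  split_ifs with h
  · simp [(hζ.pow_eq_one_iff_dvd m).mpr h]
  · have h1 : ζ ^ m ≠ 1 := fun h' => h ((hζ.pow_eq_one_iff_dvd m).mp h')
    rw [geom_sum_eq h1, ← pow_mul, mul_comm, pow_mul, hζ.pow_eq_one]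
    simp

theorem sum_range_mul_residue {q a : ℕ} (ha1 : 1 ≤ a) (ha2 : a < q) (N : ℕ) :
    ∑ i ∈ Finset.range (q * N), ((if q ∣ i + 1 then (q : ℂ) else 0) -
      (if q ∣ (i + 1) + (q - a) then (q : ℂ) else 0)) / ((i : ℂ) + 1) =
    ∑ n ∈ Finset.range N, (1 / ((n : ℂ) + 1) - 1 / ((n : ℂ) + (a : ℂ) / q)) := by
  have hq : (q : ℂ) ≠ 0 := Nat.cast_ne_zero.mpr (by omega)
  induction N with
  | zero => simp
  | succ N ih =>
    rw [mul_add, mul_one, Finset.sum_range_add, ih, Finset.sum_range_succ]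
    congr 1
    have h1 : ∀ s ∈ Finset.range q, (q ∣ q * N + s + 1 ↔ s = q - 1) := by
      intro s hs
      rw [Finset.mem_range] at hs
      rw [add_assoc, Nat.dvd_add_right (dvd_mul_right q N)]
      constructor
      · intro h
        have := Nat.le_of_dvd (by omega) h
        omega
      · rintro rfl
        rw [Nat.sub_add_cancel (by omega)]
    have h2 : ∀ s ∈ Finset.range q, (q ∣ q * N + s + 1 + (q - a) ↔ s = a - 1) := by
      intro s hs
      rw [Finset.mem_range] at hs
      rw [add_assoc, add_assoc, Nat.dvd_add_right (dvd_mul_right q N)]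
      constructor
      · rintro ⟨c, hc⟩
        have hc1 : c = 1 := by
          rcases Nat.lt_or_ge c 1 with h | h
          · interval_cases c
            omega
          · by_contra hne
            have : q * 2 ≤ q * c := Nat.mul_le_mul_left q (by omega)
            omega
        subst hc1
        omega
      · rintro rfl
        exact ⟨1, by omega⟩
    calc _ = ∑ s ∈ Finset.range q, ((if s = q - 1 then (q : ℂ) / ((q * N + s : ℕ) + 1) else 0) -
          if s = a - 1 then (q : ℂ) / ((q * N + s : ℕ) + 1) else 0) := by
          refine Finset.sum_congr rfl fun s hs => ?_
          simp only [h1 s hs, h2 s hs]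
          split_ifs <;> ring
      _ = _ := by
          rw [Finset.sum_sub_distrib, Finset.sum_ite_eq', Finset.sum_ite_eq',
            if_pos (Finset.mem_range.mpr (by omega)), if_pos (Finset.mem_range.mpr (by omega))]
          push_cast [Nat.cast_sub ha1, Nat.cast_sub (by omega : 1 ≤ q)]
          have hN : (N : ℂ) + 1 ≠ 0 := by exact_mod_cast N.succ_ne_zero
          have hN' : (q : ℂ) * N + a ≠ 0 := by
            exact_mod_cast (by omega : q * N + a ≠ 0)
          have hN'' : (N : ℂ) + a / q ≠ 0 := by
            intro h
            apply hN'
            field_simp at h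
            linear_combination h
          congr 1
          · rw [show (q : ℂ) * N + (q - 1) + 1 = q * (N + 1) by ring]
            field_simp
          · rw [show (q : ℂ) * N + (a - 1) + 1 = q * N + a by ring]
            rw [div_eq_div_iff hN' hN'']
            field_simp

theorem tendsto_sum_digamma_add_euler {x : ℝ} (hx : 0 < x) :
    Tendsto (fun N : ℕ => ∑ n ∈ Finset.range N, (1 / ((n : ℝ) + 1) - 1 / ((n : ℝ) + x))) atTop
      (𝓝 (digamma x + Real.eulerMascheroniConstant)) := by
  have hsum : Summable fun k : ℕ => 1 / ((k : ℝ) + 1) - 1 / (((k : ℝ) + 1) + x) := by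
    have h2 : Summable fun k : ℕ => x * (1 / ((k : ℝ) + 1) ^ 2) := by
      have := (summable_nat_add_iff 1).mpr (Real.summable_one_div_nat_pow.mpr one_lt_two)
      push_cast at this
      exact this.mul_left x
    refine h2.of_nonneg_of_le (fun k => ?_) fun k => ?_
    · rw [sub_nonneg]
      exact one_div_le_one_div_of_le (by positivity) (by linarith)
    · have hk : (0 : ℝ) < (k : ℝ) + 1 := by positivity
      rw [div_sub_div _ _ hk.ne' (by positivity), mul_one_div, div_le_div_iff₀ (by positivity)
        (by positivity)]
      nlinarith [mul_pos hk hx, mul_pos (mul_pos hk hx) hx]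
  have hlim : Tendsto (fun N : ℕ => 1 / ((N : ℝ) + x)) atTop (𝓝 0) :=
    tendsto_const_nhds.div_atTop
      (tendsto_atTop_add_const_right _ _ tendsto_natCast_atTop_atTop)
  have h := (hsum.hasSum.tendsto_sum_nat.const_add (-(1 / x))).add hlim
  have heq : digamma x + Real.eulerMascheroniConstant =
      -(1 / x) + ∑' k : ℕ, (1 / ((k : ℝ) + 1) - 1 / (((k : ℝ) + 1) + x)) + 0 := by
    rw [digamma]
    ring
  rw [heq]
  refine h.congr fun N => ?_
  induction N with
  | zero => simp
  | succ N ih =>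
    rw [Finset.sum_range_succ, Finset.sum_range_succ, ← ih]
    push_cast
    ring

theorem digamma_add_euler_neg {x : ℝ} (hx : 0 < x) (hx1 : x < 1) :
    digamma x + Real.eulerMascheroniConstant < 0 := by
  have hanti : Antitone fun N : ℕ =>
      ∑ n ∈ Finset.range N, (1 / ((n : ℝ) + 1) - 1 / ((n : ℝ) + x)) := by
    refine antitone_nat_of_succ_le fun N => ?_
    rw [Finset.sum_range_succ, add_le_iff_nonpos_right, sub_nonpos]
    gcongr
  refine (hanti.le_of_tendsto (tendsto_sum_digamma_add_euler hx) 1).trans_lt ?_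
  simpa using (one_lt_inv₀ hx).mpr hx1

/-- Gauss's formula for the digamma function at rational arguments. -/
theorem digamma_add_euler_eq_sum_log {q a : ℕ} (ha1 : 1 ≤ a) (ha2 : a < q) {ζ : ℂ}
    (hζ : IsPrimitiveRoot ζ q) :
    ((digamma ((a : ℝ) / q) + Real.eulerMascheroniConstant : ℝ) : ℂ) =
      ∑ k : Fin q, ((ζ ^ (k : ℕ)) ^ (q - a) - 1) * Complex.log (1 - ζ ^ (k : ℕ)) := by
  have hq0 : q ≠ 0 := by omega
  have hx : (0 : ℝ) < (a : ℝ) / q := by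
    have : (0 : ℝ) < a := by exact_mod_cast ha1
    have : (0 : ℝ) < q := by exact_mod_cast (by omega : 0 < q)
    positivity
  have hleft := (Complex.continuous_ofReal.tendsto _).comp (tendsto_sum_digamma_add_euler hx)
  have hright : Tendsto (fun N => ∑ k : Fin q, (1 - (ζ ^ (k : ℕ)) ^ (q - a)) *
      ∑ i ∈ Finset.range N, (ζ ^ (k : ℕ)) ^ (i + 1) / ((i : ℂ) + 1)) atTop
      (𝓝 (∑ k : Fin q, ((ζ ^ (k : ℕ)) ^ (q - a) - 1) * Complex.log (1 - ζ ^ (k : ℕ)))) := by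
    refine tendsto_finsetSum _ fun k _ => ?_
    by_cases hk : ζ ^ (k : ℕ) = 1
    · simp [hk]
    · have hnorm : ‖ζ ^ (k : ℕ)‖ = 1 := by
        rw [norm_pow, hζ.norm'_eq_one hq0, one_pow]
      have := (tendsto_sum_pow_div_neg_log hnorm hk).const_mul (1 - (ζ ^ (k : ℕ)) ^ (q - a))
      convert this using 2
      ring
  have hsub := hright.comp (tendsto_id.const_mul_atTop' (Nat.pos_of_ne_zero hq0))
  refine tendsto_nhds_unique hleft (hsub.congr fun N => ?_)
  simp only [Function.comp_apply, id]
  push_cast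
  rw [← sum_range_mul_residue ha1 ha2]
  simp_rw [Finset.mul_sum]
  rw [Finset.sum_comm]
  refine Finset.sum_congr rfl fun i _ => ?_
  rw [← sum_range_pow_mul_primitiveRoot hζ, ← sum_range_pow_mul_primitiveRoot hζ,
    ← Finset.sum_sub_distrib, Finset.sum_div, ← Fin.sum_univ_eq_sum_range
      (fun k => ((ζ ^ k) ^ (i + 1) - (ζ ^ k) ^ (i + 1 + (q - a))) / ((i : ℂ) + 1))]
  refine Finset.sum_congr rfl fun k _ => ?_
  rw [pow_add _ (i + 1)]
  ring

end LogarithmicForms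

/-- For `q > 1`, `1 ≤ a < q`, `gcd(a, q) = 1`, the number `ψ(a/q) + γ` is
transcendental. -/
theorem digamma_add_euler_transcendental (q a : ℕ) (hq : 1 < q)
    (ha1 : 1 ≤ a) (ha2 : a < q) (hgcd : Nat.gcd a q = 1) :
    Transcendental ℚ (digamma ((a : ℝ) / (q : ℝ)) + Real.eulerMascheroniConstant) := by
  have hζ := Complex.isPrimitiveRoot_exp q (by omega)
  set ζ := Complex.exp (2 * Real.pi * Complex.I / q)
  have hζint : IsIntegral ℤ ζ := hζ.isIntegral (by omega)
  have hformula := digamma_add_euler_eq_sum_log ha1 ha2 hζ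
  have hq0 : (0 : ℝ) < q := by exact_mod_cast (by omega : 0 < q)
  have hneg : digamma ((a : ℝ) / q) + Real.eulerMascheroniConstant < 0 :=
    digamma_add_euler_neg (div_pos (by exact_mod_cast ha1) hq0)
      ((div_lt_one hq0).mpr (by exact_mod_cast ha2))
  intro halg
  have halg' : IsAlgebraic ℚ
      ((digamma ((a : ℝ) / q) + Real.eulerMascheroniConstant : ℝ) : ℂ) :=
    halg.algebraMap (A := ℂ)
  rw [hformula] at halg'
  refine transcendental_sum_mul_log (fun k => ?_) (fun k => ?_) ?_ halg'
  · exact (((hζint.pow _).pow _).sub isIntegral_one).tower_top.isAlgebraic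
  · by_cases hk : 1 - ζ ^ (k : ℕ) = 0
    · simpa [hk] using isIntegral_one
    · rw [Complex.exp_log hk]
      exact isIntegral_one.sub (hζint.pow _)
  · rw [← hformula]
    exact Complex.ofReal_ne_zero.mpr hneg.ne
end

section
/- Let p₁, …, p_k be distinct prime numbers, let m₁, …, m_k be positive integers, set qᵢ = pᵢ^{mᵢ}, and let ζ_{qᵢ} = exp(2πi/qᵢ) for each i. Then the complex numbers 1 - ζ_{qᵢ} (for 1 ≤ i ≤ k) together with the numbers (1 - ζ_{qᵢ}^{a})/(1 - ζ_{qᵢ}) (for 1 ≤ i ≤ k and each integer a with 1 < a < qᵢ/2 and gcd(a, qᵢ) = 1) are multiplicatively independent: if a product of integer powers of these numbers equals 1, then all the integer exponents are 0. -/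
open Complex

/-- Summation by parts for a power series. -/
lemma one_sub_mul_tsum_pow_mul {z : ℂ} {g : ℕ → ℂ}
    (h : Summable fun n ↦ z ^ (n + 1) * g n) :
    (1 - z) * ∑' n, z ^ (n + 1) * g n
      = z * g 0 - ∑' n, z ^ (n + 2) * (g n - g (n + 1)) := by
  have h1 := h.tsum_eq_zero_add
  have h2 : Summable fun n ↦ z ^ (n + 2) * g (n + 1) := (summable_nat_add_iff 1).mpr h
  have h3 : Summable fun n ↦ z ^ (n + 2) * g n :=
    (h.mul_left z).congr fun n ↦ by ring
  have h4 : z * ∑' n, z ^ (n + 1) * g n = ∑' n, z ^ (n + 2) * g n := by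
    rw [← tsum_mul_left]
    exact tsum_congr fun n ↦ by ring
  simp only [mul_sub]
  rw [h3.tsum_sub h2, sub_mul, h4, one_mul, h1]
  simp only [zero_add, pow_one, add_assoc, one_add_one_eq_two]
  ring

lemma summable_two_mul_inv_succ_sq :
    Summable fun n : ℕ ↦ 2 * ((n : ℝ) + 1)⁻¹ ^ 2 := by
  have := (summable_nat_add_iff 1).mpr (Real.summable_nat_pow_inv (p := 2).mpr one_lt_two)
  refine (this.mul_left 2).congr fun n ↦ ?_
  push_cast
  rw [inv_pow]

lemma rpow_neg_sub_rpow_neg_succ_le {s : ℝ} (hs : 1 ≤ s) (hs2 : s ≤ 2) (n : ℕ) :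
    |((n : ℝ) + 1) ^ (-s) - ((n : ℝ) + 2) ^ (-s)| ≤ 2 * ((n : ℝ) + 1)⁻¹ ^ 2 := by
  have h1 : (0 : ℝ) < n + 1 := by positivity
  have h2 : (0 : ℝ) < n + 2 := by positivity
  have hle : ((n : ℝ) + 2) ^ (-s) ≤ ((n : ℝ) + 1) ^ (-s) :=
    Real.rpow_le_rpow_of_nonpos h1 (by linarith) (by linarith)
  rw [abs_of_nonneg (by linarith)]
  have hx : ((n : ℝ) + 2) ^ (-s) = ((n : ℝ) + 1) ^ (-s) * (((n : ℝ) + 1) / (n + 2)) ^ s := by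
    rw [Real.div_rpow h1.le h2.le, Real.rpow_neg h1.le, Real.rpow_neg h2.le]
    have := (Real.rpow_pos_of_pos h1 s).ne'
    field_simp
  have hq1 : ((n : ℝ) + 1) / (n + 2) ≤ 1 := by
    rw [div_le_one h2]; linarith
  have hx2 : (((n : ℝ) + 1) / (n + 2)) ^ (2 : ℕ) ≤ (((n : ℝ) + 1) / (n + 2)) ^ s := by
    rw [← Real.rpow_natCast]
    exact Real.rpow_le_rpow_of_exponent_ge (by positivity) hq1 (by simpa using hs2)
  have hx3 : ((n : ℝ) + 1) ^ (-s) ≤ ((n : ℝ) + 1)⁻¹ := by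
    rw [← Real.rpow_neg_one]
    exact Real.rpow_le_rpow_of_exponent_le (by linarith) (by linarith)
  have h5 : 0 ≤ 1 - (((n : ℝ) + 1) / (n + 2)) ^ (2 : ℕ) := by
    have : (((n : ℝ) + 1) / (n + 2)) ^ (2 : ℕ) ≤ 1 := pow_le_one₀ (by positivity) hq1
    linarith
  calc _ = ((n : ℝ) + 1) ^ (-s) * (1 - (((n : ℝ) + 1) / (n + 2)) ^ s) := by rw [hx]; ring
    _ ≤ ((n : ℝ) + 1) ^ (-s) * (1 - (((n : ℝ) + 1) / (n + 2)) ^ (2 : ℕ)) := by gcongr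
    _ ≤ ((n : ℝ) + 1)⁻¹ * (1 - (((n : ℝ) + 1) / (n + 2)) ^ (2 : ℕ)) := by gcongr
    _ ≤ ((n : ℝ) + 1)⁻¹ * (2 * ((n : ℝ) + 1)⁻¹) := by
      gcongr
      field_simp
      nlinarith
    _ = _ := by ring

lemma norm_inv_succ_sub_inv_succ_le (n : ℕ) :
    ‖((n : ℂ) + 1)⁻¹ - ((n : ℂ) + 2)⁻¹‖ ≤ 2 * ((n : ℝ) + 1)⁻¹ ^ 2 := by
  have h := rpow_neg_sub_rpow_neg_succ_le le_rfl one_le_two n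
  rw [Real.rpow_neg_one, Real.rpow_neg_one] at h
  rw [← Real.norm_eq_abs, ← Complex.norm_real] at h
  push_cast at h
  exact h

/-- The boundary value of the logarithm series. -/
lemma one_sub_mul_neg_log_one_sub {w : ℂ} (hw : ‖w‖ = 1) (hw1 : w ≠ 1) :
    (1 - w) * -log (1 - w) = w - ∑' n : ℕ, w ^ (n + 2) * (((n : ℂ) + 1)⁻¹ - ((n : ℂ) + 2)⁻¹) := by
  have hre : w.re < 1 := by
    refine lt_of_le_of_ne (hw ▸ Complex.re_le_norm w) fun h ↦ hw1 ?_
    have h2 : w.re ^ 2 + w.im ^ 2 = 1 := by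
      have := Complex.sq_norm w
      rw [hw, Complex.normSq_apply] at this
      linarith
    rw [h] at h2
    have : w.im = 0 := by nlinarith
    exact Complex.ext (by simp [h]) (by simp [this])
  have hslit : 1 - w ∈ slitPlane := Or.inl (by simpa using hre)
  have key (r : ℝ) (hr : r ∈ Set.Ioo (0 : ℝ) 1) : (1 - r * w) * -log (1 - r * w) = r * w -
      ∑' n : ℕ, (r * w) ^ (n + 2) * (((n : ℂ) + 1)⁻¹ - ((n : ℂ) + 2)⁻¹) := by
    have hn : ‖(r * w : ℂ)‖ < 1 := by
      rw [norm_mul, hw, mul_one, Complex.norm_real, Real.norm_eq_abs, abs_of_pos hr.1]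
      exact hr.2
    have h := (hasSum_nat_add_iff' 1).mpr (hasSum_taylorSeries_neg_log hn)
    simp only [Finset.range_one, Finset.sum_singleton, Nat.cast_zero, inv_zero, mul_zero,
      sub_zero, div_eq_mul_inv] at h
    have h' := one_sub_mul_tsum_pow_mul h.summable
    rw [h.tsum_eq] at h'
    rw [h']
    push_cast
    simp [add_assoc, one_add_one_eq_two]
  have hlim : Filter.Tendsto (fun r : ℝ ↦ (r * w : ℂ))
      (nhdsWithin 1 (Set.Ioo (0 : ℝ) 1)) (nhds w) := by
    refine Filter.Tendsto.mono_left ?_ nhdsWithin_le_nhds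
    have : Continuous fun r : ℝ ↦ (r * w : ℂ) := by fun_prop
    simpa using this.tendsto 1
  have hne : (nhdsWithin (1 : ℝ) (Set.Ioo (0 : ℝ) 1)).NeBot := by
    rw [nhdsWithin_Ioo_eq_nhdsLT zero_lt_one]
    infer_instance
  have hl : Filter.Tendsto (fun r : ℝ ↦ (1 - r * w) * -log (1 - r * w))
      (nhdsWithin 1 (Set.Ioo (0 : ℝ) 1)) (nhds ((1 - w) * -log (1 - w))) :=
    (tendsto_const_nhds.sub hlim).mul ((tendsto_const_nhds.sub hlim).clog hslit).neg
  have hr : Filter.Tendsto (fun r : ℝ ↦ r * w -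
      ∑' n : ℕ, (r * w) ^ (n + 2) * (((n : ℂ) + 1)⁻¹ - ((n : ℂ) + 2)⁻¹))
      (nhdsWithin 1 (Set.Ioo (0 : ℝ) 1)) (nhds (w -
      ∑' n : ℕ, w ^ (n + 2) * (((n : ℂ) + 1)⁻¹ - ((n : ℂ) + 2)⁻¹))) := by
    refine hlim.sub (tendsto_tsum_of_dominated_convergence summable_two_mul_inv_succ_sq
      (fun n ↦ (hlim.pow _).mul_const _) ?_)
    filter_upwards [self_mem_nhdsWithin] with r hr n
    rw [norm_mul, norm_pow, norm_mul, hw, mul_one, Complex.norm_real, Real.norm_eq_abs,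
      abs_of_pos hr.1]
    exact (mul_le_of_le_one_left (norm_nonneg _) (pow_le_one₀ hr.1.le hr.2.le)).trans
      (norm_inv_succ_sub_inv_succ_le n)
  refine tendsto_nhds_unique hl (hr.congr' ?_)
  filter_upwards [self_mem_nhdsWithin] with r hr using (key r hr).symm

/-- The value at `1` of the periodic zeta function. -/
lemma expZeta_one_eq_neg_log (a : ℝ) (ha : (a : UnitAddCircle) ≠ 0) :
    HurwitzZeta.expZeta a 1 = -log (1 - cexp (2 * Real.pi * I * a)) := by
  have hw1 : cexp (2 * Real.pi * I * a) ≠ 1 := by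
    rw [Ne, Complex.exp_eq_one_iff]
    rintro ⟨n, hn⟩
    refine ha ((AddCircle.coe_eq_zero_iff _).mpr ⟨n, ?_⟩)
    rw [mul_comm] at hn
    have := mul_right_cancel₀ Complex.two_pi_I_ne_zero hn
    simpa using (by exact_mod_cast this.symm : (n : ℝ) = a)
  set w := cexp (2 * Real.pi * I * a) with hwdef
  have hw : ‖w‖ = 1 := by
    rw [hwdef, show (2 * Real.pi * I * a : ℂ) = ((2 * Real.pi * a : ℝ) : ℂ) * I by push_cast; ring,
      Complex.norm_exp_ofReal_mul_I]
  have key (s : ℝ) (hs : s ∈ Set.Ioo (1 : ℝ) 2) : (1 - w) * HurwitzZeta.expZeta a s = w -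
      ∑' n : ℕ, w ^ (n + 2) * ((((n : ℝ) + 1) ^ (-s) - ((n : ℝ) + 2) ^ (-s) : ℝ) : ℂ) := by
    have h := (hasSum_nat_add_iff' 1).mpr (HurwitzZeta.hasSum_expZeta_of_one_lt_re a (s := s)
      (by simpa using hs.1))
    have hs0 : (s : ℂ) ≠ 0 := by
      have := hs.1
      exact_mod_cast (by linarith : s ≠ 0)
    simp only [Finset.range_one, Finset.sum_singleton, Nat.cast_zero, zero_cpow hs0, div_zero,
      sub_zero] at h
    have e (n : ℕ) : cexp (2 * Real.pi * I * a * (n + 1 : ℕ)) / ((n + 1 : ℕ) : ℂ) ^ (s : ℂ)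
        = w ^ (n + 1) * (((n : ℝ) + 1) ^ (-s) : ℝ) := by
      rw [hwdef, ← Complex.exp_nat_mul, mul_comm, div_eq_mul_inv, ← cpow_neg,
        Complex.ofReal_cpow (by positivity), mul_comm]
      push_cast
      ring_nf
    simp only [e] at h
    have h' := one_sub_mul_tsum_pow_mul h.summable
    rw [h.tsum_eq] at h'
    rw [h']
    simp [add_assoc, one_add_one_eq_two]
  have hne : (nhdsWithin (1 : ℝ) (Set.Ioo (1 : ℝ) 2)).NeBot := by
    rw [nhdsWithin_Ioo_eq_nhdsGT one_lt_two]
    infer_instance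
  have hl : Filter.Tendsto (fun s : ℝ ↦ (1 - w) * HurwitzZeta.expZeta a s)
      (nhdsWithin 1 (Set.Ioo (1 : ℝ) 2)) (nhds ((1 - w) * HurwitzZeta.expZeta a 1)) := by
    refine Filter.Tendsto.mono_left ?_ nhdsWithin_le_nhds
    have : Continuous fun s : ℝ ↦ (1 - w) * HurwitzZeta.expZeta a s :=
      continuous_const.mul ((HurwitzZeta.differentiable_expZeta_of_ne_zero ha).continuous.comp
        continuous_ofReal)
    simpa using this.tendsto 1
  have hr : Filter.Tendsto (fun s : ℝ ↦ w -
      ∑' n : ℕ, w ^ (n + 2) * ((((n : ℝ) + 1) ^ (-s) - ((n : ℝ) + 2) ^ (-s) : ℝ) : ℂ))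
      (nhdsWithin 1 (Set.Ioo (1 : ℝ) 2)) (nhds (w -
      ∑' n : ℕ, w ^ (n + 2) * (((n : ℂ) + 1)⁻¹ - ((n : ℂ) + 2)⁻¹))) := by
    refine tendsto_const_nhds.sub (tendsto_tsum_of_dominated_convergence
      summable_two_mul_inv_succ_sq (fun n ↦ ?_) ?_)
    · refine Filter.Tendsto.mono_left ?_ nhdsWithin_le_nhds
      have h1 : ((n : ℝ) + 1) ≠ 0 := by positivity
      have h2 : ((n : ℝ) + 2) ≠ 0 := by positivity
      have : Continuous fun s : ℝ ↦
          w ^ (n + 2) * ((((n : ℝ) + 1) ^ (-s) - ((n : ℝ) + 2) ^ (-s) : ℝ) : ℂ) :=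
        continuous_const.mul (continuous_ofReal.comp
          ((Real.continuous_const_rpow h1 |>.comp continuous_neg).sub
            (Real.continuous_const_rpow h2 |>.comp continuous_neg)))
      simpa [Real.rpow_neg_one] using this.tendsto 1
    · filter_upwards [self_mem_nhdsWithin] with s hs n
      rw [norm_mul, norm_pow, hw, one_pow, one_mul, Complex.norm_real, Real.norm_eq_abs]
      exact rpow_neg_sub_rpow_neg_succ_le hs.1.le hs.2.le n
  have := tendsto_nhds_unique hl (hr.congr' (by
    filter_upwards [self_mem_nhdsWithin] with s hs using (key s hs).symm))
  rw [← one_sub_mul_neg_log_one_sub hw hw1] at this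
  exact mul_left_cancel₀ (sub_ne_zero.mpr hw1.symm) this

/-- `log |1 - exp (2 π i j / N)|` as a function of `j : ZMod N`. -/
noncomputable def logNormOneSub {N : ℕ} [NeZero N] (j : ZMod N) : ℝ :=
  Real.log ‖1 - ZMod.stdAddChar j‖

lemma expZeta_toAddCircle_one {N : ℕ} [NeZero N] {j : ZMod N} (hj : j ≠ 0) :
    HurwitzZeta.expZeta (ZMod.toAddCircle j) 1 = -log (1 - ZMod.stdAddChar j) := by
  have h := expZeta_one_eq_neg_log (j.val / N)
    (by rwa [← ZMod.toAddCircle_apply, Ne, ZMod.toAddCircle_eq_zero])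
  rw [ZMod.toAddCircle_apply, h, ZMod.stdAddChar_apply, ZMod.toCircle_apply]
  push_cast
  ring_nf

lemma expZeta_toAddCircle_one_add_neg {N : ℕ} [NeZero N] {j : ZMod N} (hj : j ≠ 0) :
    HurwitzZeta.expZeta (ZMod.toAddCircle j) 1 + HurwitzZeta.expZeta (ZMod.toAddCircle (-j)) 1
      = -2 * logNormOneSub j := by
  rw [expZeta_toAddCircle_one hj, expZeta_toAddCircle_one (neg_ne_zero.mpr hj)]
  have hre (j : ZMod N) : (log (1 - ZMod.stdAddChar j)).re = logNormOneSub j := by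
    rw [Complex.log_re, logNormOneSub]
  have h : ZMod.stdAddChar (-j) = (starRingEnd ℂ) (ZMod.stdAddChar j) := by
    rw [ZMod.stdAddChar_apply, ZMod.stdAddChar_apply, AddChar.map_neg_eq_inv,
      Circle.coe_inv_eq_conj]
  have harg : (1 - ZMod.stdAddChar j : ℂ).arg ≠ Real.pi := by
    intro harg
    have := Complex.arg_eq_pi_iff.mp harg
    have h1 := Complex.re_le_norm (ZMod.stdAddChar j)
    rw [ZMod.stdAddChar_apply, Circle.norm_coe] at h1
    rw [ZMod.stdAddChar_apply, Complex.sub_re, Complex.one_re] at this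
    linarith [this.1]
  have h2 : (1 : ℂ) - ZMod.stdAddChar (-j) = (starRingEnd ℂ) (1 - ZMod.stdAddChar j) := by
    rw [h, map_sub, map_one]
  rw [h2, Complex.log_conj _ harg, ← neg_add, Complex.add_conj, hre]
  push_cast
  ring

/-- For a primitive even character `χ ≠ 1` the sum is a nonzero multiple of `L(1, χ⁻¹)`. -/
lemma DirichletCharacter.IsPrimitive.sum_mul_logNormOneSub_ne_zero {N : ℕ} [NeZero N]
    {χ : DirichletCharacter ℂ N} (hprim : χ.IsPrimitive) (hχ : χ ≠ 1) (heven : χ.Even) :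
    ∑ j, χ j * logNormOneSub j ≠ 0 := by
  have hN : N ≠ 1 := fun h ↦ hχ (DirichletCharacter.level_one' χ h)
  have h0 : χ 0 = 0 := χ.map_zero' hN
  have hL := ZMod.LFunction_dft (χ : ZMod N → ℂ) (s := 1) (.inl h0)
  have hneg (j : ZMod N) : χ (-j) = χ j := DirichletCharacter.Even.eval_neg χ j heven
  have hL' : ∑ j, χ j * HurwitzZeta.expZeta (ZMod.toAddCircle j) 1
      = ZMod.LFunction (ZMod.dft (χ : ZMod N → ℂ)) 1 := by
    rw [hL]
    exact Fintype.sum_equiv (Equiv.neg (ZMod N)) _ _ fun j ↦ by simp [hneg]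
  have hsum : -2 * ∑ j, χ j * logNormOneSub j
      = 2 * ZMod.LFunction (ZMod.dft (χ : ZMod N → ℂ)) 1 := by
    rw [two_mul]
    nth_rw 1 [← hL']
    rw [hL, ← Finset.sum_add_distrib, Finset.mul_sum]
    refine Finset.sum_congr rfl fun j _ ↦ ?_
    rcases eq_or_ne j 0 with rfl | hj
    · simp [h0]
    · rw [← mul_add, expZeta_toAddCircle_one_add_neg hj]
      ring
  have hdft : ZMod.dft (χ : ZMod N → ℂ)
      = fun k ↦ gaussSum χ ZMod.stdAddChar * χ⁻¹ k := by
    ext k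
    rw [hprim.fourierTransform_eq_inv_mul_gaussSum, mul_comm]
    congr 1
    rw [MulChar.inv_apply_eq_inv, MulChar.inv_apply_eq_inv, hneg]
  have hmul (c : ℂ) (Φ : ZMod N → ℂ) :
      ZMod.LFunction (fun k ↦ c * Φ k) 1 = c * ZMod.LFunction Φ 1 := by
    simp only [ZMod.LFunction, Finset.mul_sum]
    exact Finset.sum_congr rfl fun _ _ ↦ by ring
  have hg : gaussSum χ ZMod.stdAddChar ≠ 0 := by
    intro hg
    have : (χ : ZMod N → ℂ) = 0 := by
      apply (ZMod.dft (N := N) (E := ℂ)).injective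
      rw [hdft, hg, map_zero]
      ext; simp
    simpa using congrFun this 1
  intro h
  rw [h, mul_zero, hdft, hmul] at hsum
  have hinv : χ⁻¹ ≠ 1 := by simpa using hχ
  have := DirichletCharacter.LFunction_apply_one_ne_zero hinv
  rw [DirichletCharacter.LFunction] at this
  exact mul_ne_zero two_ne_zero (mul_ne_zero hg this) hsum.symm

lemma isPrimitiveRoot_stdAddChar_one (N : ℕ) [NeZero N] :
    IsPrimitiveRoot (ZMod.stdAddChar (1 : ZMod N) : ℂ) N := by
  have h := ZMod.stdAddChar_coe (N := N) 1
  rw [Int.cast_one, Int.cast_one, mul_one] at h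
  rw [h]
  exact Complex.isPrimitiveRoot_exp N (NeZero.ne N)

lemma stdAddChar_castHom {d q : ℕ} [NeZero d] [NeZero q] (h : d ∣ q) (b : ZMod q) :
    (ZMod.stdAddChar (ZMod.castHom h (ZMod d) b) : ℂ) = ZMod.stdAddChar b ^ (q / d) := by
  obtain ⟨k, rfl⟩ := ZMod.intCast_surjective b
  obtain ⟨n, rfl⟩ := h
  have hd : (d : ℂ) ≠ 0 := NeZero.ne _
  have hn : (n : ℂ) ≠ 0 := by
    have := NeZero.ne (d * n)
    exact_mod_cast right_ne_zero_of_mul this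
  rw [map_intCast, ZMod.stdAddChar_coe, ZMod.stdAddChar_coe,
    Nat.mul_div_cancel_left _ (NeZero.pos d), ← Complex.exp_nat_mul]
  congr 1
  push_cast
  field_simp

/-- The distribution relation for `log |1 - exp (2 π i j / q)|`. -/
lemma sum_fiber_logNormOneSub {d q : ℕ} [NeZero d] [NeZero q] (h : d ∣ q) {a : ZMod d}
    (ha : a ≠ 0) :
    ∑ b with ZMod.castHom h (ZMod d) b = a, logNormOneSub b = logNormOneSub a := by
  obtain ⟨b₀, rfl⟩ := ZMod.castHom_surjective h a
  have hn : 0 < q / d := Nat.div_pos (Nat.le_of_dvd (NeZero.pos q) h) (NeZero.pos d)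
  have hprod : ∏ b with ZMod.castHom h (ZMod d) b = ZMod.castHom h (ZMod d) b₀,
      (1 - ZMod.stdAddChar b : ℂ) = 1 - ZMod.stdAddChar (ZMod.castHom h (ZMod d) b₀) := by
    have hprim : IsPrimitiveRoot (ZMod.stdAddChar (1 : ZMod q) ^ d : ℂ) (q / d) :=
      (isPrimitiveRoot_stdAddChar_one q).pow (NeZero.pos q) (Nat.mul_div_cancel' h).symm
    rw [stdAddChar_castHom h b₀]
    have := hprim.pow_sub_pow_eq_prod_sub_mul 1 (ZMod.stdAddChar b₀) hn
    rw [one_pow] at this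
    rw [this]
    refine Finset.prod_bij (fun b _ ↦ ZMod.stdAddChar (b - b₀)) (fun b hb ↦ ?_)
      (fun b _ c _ hbc ↦ ?_) (fun μ hμ ↦ ?_) (fun b _ ↦ ?_)
    · rw [Finset.mem_filter] at hb
      rw [Polynomial.mem_nthRootsFinset hn, ← stdAddChar_castHom h, map_sub, hb.2, sub_self,
        AddChar.map_zero_eq_one]
    · exact sub_left_injective (ZMod.injective_stdAddChar hbc)
    · rw [Polynomial.mem_nthRootsFinset hn] at hμ
      have hμq : μ ^ q = 1 := by
        rw [← Nat.div_mul_cancel h, pow_mul, hμ, one_pow]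
      obtain ⟨i, -, rfl⟩ := (isPrimitiveRoot_stdAddChar_one q).eq_pow_of_pow_eq_one hμq
      rw [← AddChar.map_nsmul_eq_pow] at hμ ⊢
      rw [← stdAddChar_castHom h, ← AddChar.map_zero_eq_one (ZMod.stdAddChar (N := d))] at hμ
      have hi := ZMod.injective_stdAddChar hμ
      refine ⟨b₀ + i • 1, ?_, by rw [add_sub_cancel_left]⟩
      rw [Finset.mem_filter, map_add, hi, add_zero]
      exact ⟨Finset.mem_univ _, rfl⟩
    · rw [← AddChar.map_add_eq_mul, sub_add_cancel]
  rw [logNormOneSub, ← hprod, norm_prod, Real.log_prod]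
  · rfl
  · intro b hb
    rw [Finset.mem_filter] at hb
    rw [norm_ne_zero_iff, sub_ne_zero]
    intro hb1
    rw [← AddChar.map_zero_eq_one (ZMod.stdAddChar (N := q))] at hb1
    rw [← ZMod.injective_stdAddChar hb1, map_zero] at hb
    exact ha hb.2.symm

lemma DirichletCharacter.sum_mul_logNormOneSub_ne_zero {p m : ℕ} (hp : p.Prime) [NeZero (p ^ m)]
    {χ : DirichletCharacter ℂ (p ^ m)} (hχ : χ ≠ 1) (heven : χ.Even) :
    ∑ j, χ j * logNormOneSub j ≠ 0 := by
  have hd0 : NeZero χ.conductor := ⟨χ.conductor_ne_zero⟩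
  have hdvd := χ.conductor_dvd_level
  have hχ0 : χ.primitiveCharacter ≠ 1 := by
    rw [Ne, ← DirichletCharacter.changeLevel_eq_one_iff hdvd,
      DirichletCharacter.changeLevel_primitiveCharacter]
    exact hχ
  have hd1 : χ.conductor ≠ 1 := fun h ↦ hχ0 (DirichletCharacter.level_one' _ h)
  have heven0 : χ.primitiveCharacter.Even := by
    have := χ.primitiveCharacter_apply_of_isCoprime (a := -1) isCoprime_one_left.neg_left
    push_cast at this
    rw [DirichletCharacter.Even, this, heven]
  obtain ⟨r, -, hr⟩ := (Nat.dvd_prime_pow hp).mp hdvd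
  have hr0 : 0 < r := Nat.pos_of_ne_zero fun h ↦ hd1 (by rw [hr, h, pow_zero])
  have hval (b : ZMod (p ^ m)) :
      χ b = χ.primitiveCharacter (ZMod.castHom hdvd (ZMod χ.conductor) b) := by
    obtain ⟨k, rfl⟩ := ZMod.intCast_surjective b
    rw [map_intCast (ZMod.castHom hdvd (ZMod χ.conductor))]
    by_cases hk : IsCoprime k ((p ^ m : ℕ) : ℤ)
    · exact (χ.primitiveCharacter_apply_of_isCoprime hk).symm
    · rw [(χ.apply_eq_zero_iff k).mpr hk, eq_comm, DirichletCharacter.apply_eq_zero_iff]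
      contrapose! hk
      rw [hr, Nat.cast_pow, IsCoprime.pow_right_iff hr0] at hk
      rw [Nat.cast_pow]
      exact hk.pow_right
  have hsum : ∑ j, χ j * logNormOneSub j
      = ∑ a, χ.primitiveCharacter a * logNormOneSub a := by
    rw [← Finset.sum_fiberwise Finset.univ (ZMod.castHom hdvd (ZMod χ.conductor))]
    refine Finset.sum_congr rfl fun a _ ↦ ?_
    rcases eq_or_ne a 0 with rfl | ha
    · rw [χ.primitiveCharacter.map_zero' hd1, zero_mul]
      refine Finset.sum_eq_zero fun b hb ↦ ?_
      rw [hval, (Finset.mem_filter.mp hb).2, χ.primitiveCharacter.map_zero' hd1, zero_mul]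
    · rw [← sum_fiber_logNormOneSub hdvd ha, Complex.ofReal_sum, Finset.mul_sum]
      refine Finset.sum_congr rfl fun b hb ↦ ?_
      rw [hval, (Finset.mem_filter.mp hb).2]
  rw [hsum]
  exact χ.primitiveCharacter_isPrimitive.sum_mul_logNormOneSub_ne_zero hχ0 heven0

lemma sum_mul_apply_eq_zero_of_const {p m : ℕ} (hp : p.Prime) [NeZero (p ^ m)]
    {E : ZMod (p ^ m) → ℂ} (hsupp : ∀ a, ¬ IsUnit a → E a = 0) {c : ℂ}
    (hconst : ∀ b, IsUnit b → ∑ a, E a * logNormOneSub (a * b) = c)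
    {χ : DirichletCharacter ℂ (p ^ m)} (hχ : χ ≠ 1) (heven : χ.Even) :
    ∑ a, E a * χ a = 0 := by
  have hinv : χ⁻¹ ≠ 1 := by simpa using hχ
  have hinveven : (χ⁻¹).Even := by
    rw [DirichletCharacter.Even, MulChar.inv_apply_eq_inv, heven, Ring.inverse_one]
  have h1 : ∑ b, χ⁻¹ b * ∑ a, E a * logNormOneSub (a * b) = 0 := by
    calc _ = ∑ b, χ⁻¹ b * c := by
          refine Finset.sum_congr rfl fun b _ ↦ ?_
          by_cases hb : IsUnit b
          · rw [hconst b hb]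
          · rw [MulChar.map_nonunit _ hb, zero_mul, zero_mul]
      _ = 0 := by rw [← Finset.sum_mul, MulChar.sum_eq_zero_of_ne_one hinv, zero_mul]
  have h2 : ∑ b, χ⁻¹ b * ∑ a, E a * logNormOneSub (a * b)
      = (∑ a, E a * χ a) * ∑ b, χ⁻¹ b * logNormOneSub b := by
    rw [Finset.sum_congr rfl fun b _ ↦ Finset.mul_sum .., Finset.sum_comm, Finset.sum_mul]
    refine Finset.sum_congr rfl fun a _ ↦ ?_
    by_cases ha : IsUnit a
    · obtain ⟨u, rfl⟩ := ha
      have e : ∑ b, χ⁻¹ ((u : ZMod (p ^ m)) * b) * (logNormOneSub ((u : ZMod (p ^ m)) * b) : ℂ)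
          = ∑ b, χ⁻¹ b * (logNormOneSub b : ℂ) :=
        Fintype.sum_equiv (Units.mulLeft u) _ _ fun _ ↦ rfl
      rw [← e, Finset.mul_sum]
      refine Finset.sum_congr rfl fun b _ ↦ ?_
      have : χ u * χ⁻¹ u = 1 := by
        rw [← MulChar.mul_apply, mul_inv_cancel, MulChar.one_apply_coe]
      rw [map_mul]
      linear_combination
        -(χ⁻¹ b * E u * (logNormOneSub ((u : ZMod (p ^ m)) * b) : ℂ)) * this
    · simp [hsupp a ha]
  rw [h2] at h1
  exact (mul_eq_zero.mp h1).resolve_right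
    (DirichletCharacter.sum_mul_logNormOneSub_ne_zero hp hinv hinveven)

lemma add_apply_neg_eq_zero_of_const {p m : ℕ} (hp : p.Prime) [NeZero (p ^ m)]
    {E : ZMod (p ^ m) → ℂ} (hsupp : ∀ a, ¬ IsUnit a → E a = 0) {c : ℂ}
    (hconst : ∀ b, IsUnit b → ∑ a, E a * logNormOneSub (a * b) = c)
    (hsum : ∑ a, E a = 0) (a : ZMod (p ^ m)) : E a + E (-a) = 0 := by
  by_cases ha : IsUnit a
  swap
  · rw [hsupp a ha, hsupp (-a) (by simpa using ha), add_zero]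
  have hT (χ : DirichletCharacter ℂ (p ^ m)) : ∑ b, (E b + E (-b)) * χ b = 0 := by
    have h1 : ∑ b, (E b + E (-b)) * χ b = (1 + χ (-1)) * ∑ b, E b * χ b := by
      have : ∑ b, E (-b) * χ b = ∑ b, E b * χ (-b) :=
        Fintype.sum_equiv (Equiv.neg _) _ _ fun b ↦ by simp
      simp only [add_mul, Finset.sum_add_distrib, one_mul, this, Finset.mul_sum]
      congr 1
      refine Finset.sum_congr rfl fun b _ ↦ ?_
      rw [← neg_one_mul b, map_mul]
      ring
    rcases χ.even_or_odd with heven | hodd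
    · rw [h1]
      rcases eq_or_ne χ 1 with rfl | hχ
      · suffices ∑ b, E b * (1 : DirichletCharacter ℂ (p ^ m)) b = 0 by rw [this, mul_zero]
        rw [← hsum]
        refine Finset.sum_congr rfl fun b _ ↦ ?_
        by_cases hb : IsUnit b
        · rw [MulChar.one_apply hb, mul_one]
        · rw [hsupp b hb, zero_mul]
      · rw [sum_mul_apply_eq_zero_of_const hp hsupp hconst hχ heven, mul_zero]
    · rw [h1, hodd, add_neg_cancel, zero_mul]
  have h : ∑ χ : DirichletCharacter ℂ (p ^ m), χ a⁻¹ * ∑ b, (E b + E (-b)) * χ b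
      = (p ^ m).totient * (E a + E (-a)) := by
    simp only [Finset.mul_sum]
    rw [Finset.sum_comm]
    have (b : ZMod (p ^ m)) : ∑ χ : DirichletCharacter ℂ (p ^ m), χ a⁻¹ * ((E b + E (-b)) * χ b)
        = (if a = b then ((p ^ m).totient : ℂ) else 0) * (E b + E (-b)) := by
      rw [← DirichletCharacter.sum_char_inv_mul_char_eq ℂ ha, Finset.sum_mul]
      exact Finset.sum_congr rfl fun _ _ ↦ by ring
    simp [this]
  simp only [hT, mul_zero, Finset.sum_const_zero] at h
  refine (mul_eq_zero.mp h.symm).resolve_left ?_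
  exact_mod_cast (Nat.totient_pos.mpr (NeZero.pos (p ^ m))).ne'

lemma sum_isUnit_logNormOneSub {p m : ℕ} (hp : p.Prime) (hm : 0 < m) [NeZero (p ^ m)] :
    ∑ b : (ZMod (p ^ m))ˣ, logNormOneSub (b : ZMod (p ^ m)) = Real.log p := by
  have hprim := isPrimitiveRoot_stdAddChar_one (p ^ m)
  have hprod : ∏ b : (ZMod (p ^ m))ˣ, (1 - ZMod.stdAddChar (b : ZMod (p ^ m)) : ℂ) = p := by
    obtain ⟨k, rfl⟩ : ∃ k, m = k + 1 := ⟨m - 1, by omega⟩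
    have : Fact p.Prime := ⟨hp⟩
    rw [← Polynomial.eval_one_cyclotomic_prime_pow (R := ℂ) (p := p) k,
      Polynomial.cyclotomic_eq_prod_X_sub_primitiveRoots hprim, Polynomial.eval_prod]
    refine Finset.prod_bij (fun b _ ↦ ZMod.stdAddChar (b : ZMod (p ^ (k + 1)))) (fun b _ ↦ ?_)
      (fun b _ c _ hbc ↦ ?_) (fun μ hμ ↦ ?_) (fun b _ ↦ by simp)
    · rw [mem_primitiveRoots (NeZero.pos _)]
      have h := hprim.pow_of_coprime _ (ZMod.val_coe_unit_coprime b)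
      rwa [← AddChar.map_nsmul_eq_pow, nsmul_one, ZMod.natCast_zmod_val] at h
    · exact Units.ext (ZMod.injective_stdAddChar hbc)
    · rw [mem_primitiveRoots (NeZero.pos _)] at hμ
      obtain ⟨i, -, hi, rfl⟩ := hprim.isPrimitiveRoot_iff.mp hμ
      refine ⟨ZMod.unitOfCoprime i hi, Finset.mem_univ _, ?_⟩
      rw [ZMod.coe_unitOfCoprime, ← AddChar.map_nsmul_eq_pow, nsmul_one]
  have hnorm := congrArg (fun z : ℂ ↦ Real.log ‖z‖) hprod
  simp only [norm_prod, Complex.norm_natCast] at hnorm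
  rw [← hnorm, Real.log_prod]
  · rfl
  · intro b _ hb
    have : (p : ℝ) = 0 := by
      rw [← Complex.norm_natCast, ← hprod, norm_prod]
      exact Finset.prod_eq_zero (Finset.mem_univ b) hb
    exact hp.ne_zero (by exact_mod_cast this)

/-- Logarithms of distinct primes are linearly independent over `ℤ`. -/
lemma eq_zero_of_sum_mul_log_prime_eq_zero {ι : Type*} [Fintype ι] {p : ι → ℕ}
    (hp : ∀ i, (p i).Prime) (hinj : Function.Injective p) (c : ι → ℤ)
    (h : ∑ i, (c i : ℝ) * Real.log (p i) = 0) (i : ι) : c i = 0 := by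
  have hprod : ∏ j, (p j : ℚ) ^ c j = 1 := by
    have hpos : 0 < ∏ j, (p j : ℝ) ^ c j :=
      Finset.prod_pos fun j _ ↦ zpow_pos (by exact_mod_cast (hp j).pos) _
    have : Real.log (∏ j, (p j : ℝ) ^ c j) = 0 := by
      rw [Real.log_prod, ← h]
      · exact Finset.sum_congr rfl fun j _ ↦ Real.log_zpow _ _
      · exact fun j _ ↦ zpow_ne_zero _ (by exact_mod_cast (hp j).ne_zero)
    have := Real.eq_one_of_pos_of_log_eq_zero hpos this
    apply Rat.cast_injective (α := ℝ)
    push_cast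
    exact this
  have : Fact (p i).Prime := ⟨hp i⟩
  have hv := congrArg (padicValRat (p i)) hprod
  have hval (s : Finset ι) : padicValRat (p i) (∏ j ∈ s, (p j : ℚ) ^ c j)
      = ∑ j ∈ s, c j * padicValRat (p i) (p j) := by
    classical
    induction s using Finset.induction_on with
    | empty => simp
    | insert a s ha ih =>
      have hne (j : ι) : (p j : ℚ) ^ c j ≠ 0 := zpow_ne_zero _ (by exact_mod_cast (hp j).ne_zero)
      rw [Finset.prod_insert ha, Finset.sum_insert ha,
        padicValRat.mul (hne a) (Finset.prod_ne_zero_iff.mpr fun j _ ↦ hne j), ih,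
        padicValRat.zpow]
  rw [hval, padicValRat.one, Finset.sum_eq_single i] at hv
  · simpa [padicValNat.self (hp i).one_lt] using hv
  · intro j _ hj
    have : Fact (p j).Prime := ⟨hp j⟩
    rw [padicValRat.of_nat, padicValNat_primes (fun h ↦ hj (hinj h).symm)]
    simp
  · simp

/-- A relation among the numbers at a single prime power which holds for all Galois conjugates up
to a common constant: the exponent of `1 - ζ` is determined by the constant. -/
lemma mul_log_prime_eq_totient_mul {p m : ℕ} (hp : p.Prime) (hm : 0 < m) [NeZero (p ^ m)]
    {α c : ℝ} {β : ℕ → ℝ} {S : Finset ℕ} (hS : ∀ a ∈ S, a.Coprime (p ^ m))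
    (hconst : ∀ b : (ZMod (p ^ m))ˣ, α * logNormOneSub (b : ZMod (p ^ m)) +
      ∑ a ∈ S, β a * (logNormOneSub (a * b : ZMod (p ^ m)) - logNormOneSub (b : ZMod (p ^ m))) = c) :
    α * Real.log p = (p ^ m).totient * c := by
  have h : ∑ b : (ZMod (p ^ m))ˣ, (α * logNormOneSub (b : ZMod (p ^ m)) +
      ∑ a ∈ S, β a * (logNormOneSub (a * b : ZMod (p ^ m)) - logNormOneSub (b : ZMod (p ^ m))))
      = (p ^ m).totient * c := by
    simp only [hconst, Finset.sum_const, Finset.card_univ, ZMod.card_units_eq_totient,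
      nsmul_eq_mul]
  rw [← h, Finset.sum_add_distrib, ← Finset.mul_sum, sum_isUnit_logNormOneSub hp hm,
    Finset.sum_comm, left_eq_add]
  refine Finset.sum_eq_zero fun a ha ↦ ?_
  rw [← Finset.mul_sum, Finset.sum_sub_distrib, mul_eq_zero, sub_eq_zero]
  right
  exact Fintype.sum_equiv (Equiv.mulLeft (ZMod.unitOfCoprime a (hS a ha))) _ _ fun b ↦ by simp

lemma exponent_eq_zero_of_const {p m : ℕ} (hp : p.Prime) [NeZero (p ^ m)] {c : ℝ} {β : ℕ → ℝ}
    {S : Finset ℕ} (hS : ∀ a ∈ S, 1 < a ∧ 2 * a < p ^ m ∧ a.Coprime (p ^ m))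
    (hconst : ∀ b : (ZMod (p ^ m))ˣ,
      ∑ a ∈ S, β a * (logNormOneSub (a * b : ZMod (p ^ m)) - logNormOneSub (b : ZMod (p ^ m))) = c)
    {a : ℕ} (ha : a ∈ S) : β a = 0 := by
  let E : ZMod (p ^ m) → ℂ := fun u ↦
    ∑ a ∈ S, (β a : ℂ) * ((if u = a then 1 else 0) - if u = 1 then 1 else 0)
  have hE (g : ZMod (p ^ m) → ℂ) : ∑ u, E u * g u = ∑ a ∈ S, (β a : ℂ) * (g a - g 1) := by
    simp only [E, Finset.sum_mul]
    rw [Finset.sum_comm]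
    refine Finset.sum_congr rfl fun a _ ↦ ?_
    simp [mul_assoc, ← Finset.mul_sum, sub_mul, Finset.sum_sub_distrib]
  have hsupp (u : ZMod (p ^ m)) (hu : ¬ IsUnit u) : E u = 0 := by
    refine Finset.sum_eq_zero fun a ha ↦ ?_
    rw [if_neg, if_neg, sub_zero, mul_zero]
    · rintro rfl
      exact hu isUnit_one
    · rintro rfl
      exact hu ((ZMod.isUnit_iff_coprime _ _).mpr (hS a ha).2.2)
  have hconst' (b : ZMod (p ^ m)) (hb : IsUnit b) : ∑ u, E u * logNormOneSub (u * b) = (c : ℂ) := by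
    obtain ⟨b, rfl⟩ := hb
    rw [hE (fun u ↦ logNormOneSub (u * (b : ZMod (p ^ m)))), ← hconst b]
    push_cast
    simp
  have hsum : ∑ u, E u = 0 := by
    simpa using hE fun _ ↦ 1
  have h := add_apply_neg_eq_zero_of_const hp hsupp hconst' hsum a
  obtain ⟨ha1, ha2, -⟩ := hS a ha
  have cast_inj {x y : ℕ} (hx : x < p ^ m) (hy : y < p ^ m)
      (hxy : (x : ZMod (p ^ m)) = y) : x = y :=
    Nat.ModEq.eq_of_lt_of_lt ((ZMod.natCast_eq_natCast_iff _ _ _).mp hxy) hx hy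
  have hneg {y : ℕ} (hy : 2 * y < p ^ m) : (-a : ZMod (p ^ m)) ≠ y := by
    intro h
    have h' : ((a + y : ℕ) : ZMod (p ^ m)) = (0 : ℕ) := by
      push_cast
      rw [← h]
      ring
    have := cast_inj (by omega) (by omega) h'
    omega
  have hEa : E a = β a := by
    have h1 : (a : ZMod (p ^ m)) ≠ 1 := fun h ↦ by
      have := cast_inj (x := a) (y := 1) (by omega) (by omega) (by simpa using h)
      omega
    simp only [E]
    rw [Finset.sum_eq_single a]
    · simp [h1]
    · intro b hb hba
      have : (a : ZMod (p ^ m)) ≠ b := fun h ↦ hba <| by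
        have hb2 := (hS b hb).2.1
        exact (cast_inj (by omega) (by omega) h).symm
      simp [h1, this]
    · exact fun h ↦ absurd ha h
  have hEna : E (-a) = 0 := by
    refine Finset.sum_eq_zero fun b hb ↦ ?_
    have h1 := hneg (y := 1) (by omega)
    rw [Nat.cast_one] at h1
    simp [h1, hneg (hS b hb).2.1]
  rw [hEa, hEna, add_zero] at h
  exact_mod_cast h

/-- Any two primitive complex `N`-th roots of unity are images of one element of a number field. -/
lemma IsPrimitiveRoot.exists_field_embeddings {N : ℕ} [NeZero N] {z w : ℂ}
    (hz : IsPrimitiveRoot z N) (hw : IsPrimitiveRoot w N) :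
    ∃ K : IntermediateField ℚ ℂ, ∃ φ ψ : K →+* ℂ, ∃ x, φ x = z ∧ ψ x = w := by
  have hint : IsIntegral ℚ z := (hz.isIntegral (NeZero.pos N)).tower_top
  have hroot : Polynomial.aeval w (minpoly ℚ z) = 0 := by
    have h := minpoly.aeval ℚ w
    rwa [← Polynomial.cyclotomic_eq_minpoly_rat hw (NeZero.pos N),
      Polynomial.cyclotomic_eq_minpoly_rat hz (NeZero.pos N)] at h
  let e := (IntermediateField.algHomAdjoinIntegralEquiv ℚ (K := ℂ) hint).symm
    ⟨w, (Polynomial.mem_aroots).mpr ⟨minpoly.ne_zero hint, hroot⟩⟩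
  refine ⟨IntermediateField.adjoin ℚ {z}, algebraMap _ ℂ, e,
    IntermediateField.AdjoinSimple.gen ℚ z, ?_, ?_⟩
  · exact IntermediateField.AdjoinSimple.algebraMap_gen ℚ z
  · exact IntermediateField.algHomAdjoinIntegralEquiv_symm_apply_gen ℚ hint _

open Finset in
/-- A multiplicative relation among the numbers `1 - ζ` and `(1 - ζ ^ a) / (1 - ζ)` is preserved by
simultaneous Galois conjugation at coprime levels. -/
lemma prod_conjugate_eq_one {ι : Type*} [Fintype ι] {q : ι → ℕ} [∀ i, NeZero (q i)]
    (hq : Pairwise (Function.onFun Nat.Coprime q)) (S : ι → Finset ℕ) (α : ι → ℤ) (β : ι → ℕ → ℤ)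
    (h : ∏ i, ((1 - ZMod.stdAddChar (1 : ZMod (q i)) : ℂ) ^ α i *
      ∏ a ∈ S i, ((1 - ZMod.stdAddChar (1 : ZMod (q i)) ^ a : ℂ) /
        (1 - ZMod.stdAddChar (1 : ZMod (q i)))) ^ β i a) = 1)
    (b : ∀ i, (ZMod (q i))ˣ) :
    ∏ i, ((1 - ZMod.stdAddChar (b i : ZMod (q i)) : ℂ) ^ α i *
      ∏ a ∈ S i, ((1 - ZMod.stdAddChar (a * b i : ZMod (q i)) : ℂ) /
        (1 - ZMod.stdAddChar (b i : ZMod (q i)))) ^ β i a) = 1 := by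
  have hN : NeZero (∏ i, q i) := ⟨prod_ne_zero_iff.mpr fun i _ ↦ NeZero.ne (q i)⟩
  have hdvd (i : ι) : q i ∣ ∏ i, q i := dvd_prod_of_mem q (mem_univ i)
  obtain ⟨k, hk, hkb⟩ : ∃ k : ℕ, k.Coprime (∏ i, q i) ∧ ∀ i, (k : ZMod (q i)) = b i := by
    let e := ZMod.prodEquivPi q hq
    let x := e.symm fun i ↦ (b i : ZMod (q i))
    have hx : e x = fun i ↦ (b i : ZMod (q i)) := e.apply_symm_apply _
    have hxu : IsUnit x := by
      rw [← MulEquiv.isUnit_map e, hx, Pi.isUnit_iff]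
      exact fun i ↦ (b i).isUnit
    refine ⟨x.val, ?_, fun i ↦ ?_⟩
    · rw [← ZMod.isUnit_iff_coprime, ZMod.natCast_zmod_val]
      exact hxu
    · have := congrFun hx i
      rw [← ZMod.natCast_zmod_val x, map_natCast] at this
      simpa using this
  have hz := isPrimitiveRoot_stdAddChar_one (∏ i, q i)
  obtain ⟨K, φ, ψ, x, hφ, hψ⟩ := hz.exists_field_embeddings (hz.pow_of_coprime k hk)
  have hφi (i : ι) : φ (x ^ ((∏ i, q i) / q i)) = ZMod.stdAddChar (1 : ZMod (q i)) := by
    rw [map_pow, hφ, ← stdAddChar_castHom (hdvd i), map_one]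
  have hψi (i : ι) : ψ (x ^ ((∏ i, q i) / q i)) = ZMod.stdAddChar (b i : ZMod (q i)) := by
    rw [map_pow, hψ, pow_right_comm, ← stdAddChar_castHom (hdvd i), map_one,
      ← AddChar.map_nsmul_eq_pow, nsmul_one, hkb]
  have hx : ∏ i, ((1 - x ^ ((∏ i, q i) / q i)) ^ α i *
      ∏ a ∈ S i, ((1 - (x ^ ((∏ i, q i) / q i)) ^ a) /
        (1 - x ^ ((∏ i, q i) / q i))) ^ β i a) = 1 := by
    apply φ.injective
    rw [map_one, ← h]
    simp only [map_prod, map_mul, map_zpow₀, map_div₀, map_sub, map_one, map_pow φ _ (_ : ℕ), ← hφi]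
  have hab (i : ι) (a : ℕ) : (ZMod.stdAddChar (a * b i : ZMod (q i)) : ℂ) =
      ψ ((x ^ ((∏ i, q i) / q i)) ^ a) := by
    rw [map_pow, hψi, ← AddChar.map_nsmul_eq_pow, nsmul_eq_mul]
  refine Eq.trans ?_ ((congrArg ψ hx).trans (map_one ψ))
  simp only [map_prod, map_mul, map_zpow₀, map_div₀, map_sub, map_one, hab, ← hψi]

lemma log_norm_one_sub_prod {N : ℕ} [NeZero N] (hN : N ≠ 1) {S : Finset ℕ}
    (hS : ∀ a ∈ S, a.Coprime N) (α : ℤ) (β : ℕ → ℤ) (b : (ZMod N)ˣ) :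
    ‖(1 - ZMod.stdAddChar (b : ZMod N) : ℂ) ^ α * ∏ a ∈ S,
      ((1 - ZMod.stdAddChar (a * b : ZMod N) : ℂ) / (1 - ZMod.stdAddChar (b : ZMod N))) ^ β a‖ ≠ 0 ∧
    Real.log ‖(1 - ZMod.stdAddChar (b : ZMod N) : ℂ) ^ α * ∏ a ∈ S,
      ((1 - ZMod.stdAddChar (a * b : ZMod N) : ℂ) / (1 - ZMod.stdAddChar (b : ZMod N))) ^ β a‖ =
      α * logNormOneSub (b : ZMod N) +
      ∑ a ∈ S, β a * (logNormOneSub (a * b : ZMod N) - logNormOneSub (b : ZMod N)) := by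
  have : Nontrivial (ZMod N) := ZMod.nontrivial_iff.mpr hN
  have hne {c : ZMod N} (hc : IsUnit c) : ‖(1 - ZMod.stdAddChar c : ℂ)‖ ≠ 0 := by
    rw [norm_ne_zero_iff, sub_ne_zero]
    intro h
    rw [← AddChar.map_zero_eq_one (ZMod.stdAddChar (N := N))] at h
    exact hc.ne_zero (ZMod.injective_stdAddChar h).symm
  have hab {a : ℕ} (ha : a ∈ S) : IsUnit (a * b : ZMod N) :=
    ((ZMod.isUnit_iff_coprime _ _).mpr (hS a ha)).mul b.isUnit
  simp only [norm_mul, norm_zpow, norm_prod, norm_div]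
  have h1 := zpow_ne_zero α (hne b.isUnit)
  have h2 (a : ℕ) (ha : a ∈ S) := zpow_ne_zero (β a) (div_ne_zero (hne (hab ha)) (hne b.isUnit))
  have h3 := Finset.prod_ne_zero_iff.mpr h2
  refine ⟨mul_ne_zero h1 h3, ?_⟩
  rw [Real.log_mul h1 h3, Real.log_zpow, Real.log_prod h2]
  congr 1
  refine Finset.sum_congr rfl fun a ha ↦ ?_
  rw [Real.log_zpow, Real.log_div (hne (hab ha)) (hne b.isUnit)]
  rfl

/-- Let `p₁, …, p_k` be distinct primes, `qᵢ = pᵢ^{mᵢ}` with `mᵢ ≥ 1`, and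
`ζ_{qᵢ} = exp(2πi/qᵢ)`.  The numbers `1 - ζ_{qᵢ}` together with the numbers
`(1 - ζ_{qᵢ}^a)/(1 - ζ_{qᵢ})`, for `1 < a < qᵢ/2` with `gcd(a, qᵢ) = 1`,
are multiplicatively independent. -/
theorem mult_indep_prime_power_cyclotomic_units (k : ℕ) (p m : Fin k → ℕ)
    (hp : ∀ i, (p i).Prime) (hpinj : Function.Injective p) (hm : ∀ i, 0 < m i)
    (q : Fin k → ℕ) (hq : ∀ i, q i = p i ^ m i)
    (ζ : Fin k → ℂ) (hζ : ∀ i, ζ i = Complex.exp (2 * Real.pi * Complex.I / (q i : ℂ)))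
    (α : Fin k → ℤ) (β : Fin k → ℕ → ℤ)
    (hprod : ∏ i, ((1 - ζ i) ^ α i *
        ∏ a ∈ (Finset.range (q i)).filter
            (fun a => 1 < a ∧ 2 * a < q i ∧ Nat.gcd a (q i) = 1),
          ((1 - (ζ i) ^ a) / (1 - ζ i)) ^ β i a) = 1) :
    (∀ i, α i = 0) ∧
      (∀ i a, 1 < a → 2 * a < q i → Nat.gcd a (q i) = 1 → β i a = 0) := by
  obtain rfl : q = fun i ↦ p i ^ m i := funext hq
  have hne (i : Fin k) : NeZero (p i ^ m i) := ⟨pow_ne_zero _ (hp i).ne_zero⟩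
  have hne1 (i : Fin k) : p i ^ m i ≠ 1 := (Nat.one_lt_pow (hm i).ne' (hp i).one_lt).ne'
  have hζ' : ζ = fun i ↦ (ZMod.stdAddChar (1 : ZMod (p i ^ m i)) : ℂ) := by
    ext i
    have h := ZMod.stdAddChar_coe (N := p i ^ m i) 1
    rw [Int.cast_one, Int.cast_one, mul_one] at h
    rw [hζ, h]
  subst hζ'
  have hcop : Pairwise (Function.onFun Nat.Coprime fun i ↦ p i ^ m i) := fun i j hij ↦
    Nat.Coprime.pow _ _ ((Nat.coprime_primes (hp i) (hp j)).mpr (hpinj.ne hij))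
  let S : Fin k → Finset ℕ := fun i ↦ (Finset.range (p i ^ m i)).filter
    (fun a => 1 < a ∧ 2 * a < p i ^ m i ∧ Nat.gcd a (p i ^ m i) = 1)
  have hS (i : Fin k) (a : ℕ) (ha : a ∈ S i) :
      1 < a ∧ 2 * a < p i ^ m i ∧ a.Coprime (p i ^ m i) := (Finset.mem_filter.mp ha).2
  let F (i : Fin k) (b : (ZMod (p i ^ m i))ˣ) : ℝ :=
    α i * logNormOneSub (b : ZMod (p i ^ m i)) + ∑ a ∈ S i, β i a *
      (logNormOneSub (a * b : ZMod (p i ^ m i)) - logNormOneSub (b : ZMod (p i ^ m i)))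
  have hF (b : ∀ i, (ZMod (p i ^ m i))ˣ) : ∑ i, F i (b i) = 0 := by
    have h := congrArg (fun z : ℂ ↦ Real.log ‖z‖) (prod_conjugate_eq_one hcop S α β hprod b)
    have hlog (i : Fin k) :=
      log_norm_one_sub_prod (hne1 i) (fun a ha ↦ (hS i a ha).2.2) (α i) (β i) (b i)
    simp only [norm_one, Real.log_one] at h
    rw [norm_prod, Real.log_prod fun i _ ↦ (hlog i).1] at h
    rw [← h]
    exact Finset.sum_congr rfl fun i _ ↦ (hlog i).2.symm
  have hconst (i : Fin k) (b : (ZMod (p i ^ m i))ˣ) : F i b = F i 1 := by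
    have h1 := hF (Function.update 1 i b)
    have h2 := hF 1
    rw [← Finset.add_sum_erase _ _ (Finset.mem_univ i)] at h1 h2
    rw [Finset.sum_congr rfl (g := fun j ↦ F j ((1 : ∀ i, (ZMod (p i ^ m i))ˣ) j)) fun j hj ↦ by
      rw [Function.update_of_ne (Finset.ne_of_mem_erase hj)]] at h1
    rw [Function.update_self] at h1
    simp only [Pi.one_apply] at h1 h2
    linarith
  have hα' (i : Fin k) : (α i : ℝ) * Real.log (p i) = (p i ^ m i).totient * F i 1 :=
    mul_log_prime_eq_totient_mul (hp i) (hm i) (β := fun a ↦ β i a)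
      (fun a ha ↦ (hS i a ha).2.2) (hconst i)
  have hα (i : Fin k) : α i = 0 := by
    let t : Fin k → ℕ := fun j ↦ (p j ^ m j).totient
    have ht (j : Fin k) : t j ≠ 0 := (Nat.totient_pos.mpr (NeZero.pos (p j ^ m j))).ne'
    have hsum : ∑ i, ((α i * ∏ j ∈ Finset.univ.erase i, (t j : ℤ) : ℤ) : ℝ) * Real.log (p i)
        = 0 := by
      calc _ = ∑ i, (∏ j, (t j : ℝ)) * F i 1 := by
            refine Finset.sum_congr rfl fun i _ ↦ ?_
            rw [← Finset.mul_prod_erase _ _ (Finset.mem_univ i)]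
            push_cast
            linear_combination (∏ j ∈ Finset.univ.erase i, (t j : ℝ)) * hα' i
        _ = 0 := by
            rw [← Finset.mul_sum, show ∑ i, F i 1 = 0 from hF 1, mul_zero]
    refine (mul_eq_zero.mp (eq_zero_of_sum_mul_log_prime_eq_zero hp hpinj _ hsum i)).resolve_right ?_
    exact Finset.prod_ne_zero_iff.mpr fun j _ ↦ by exact_mod_cast ht j
  refine ⟨hα, fun i a ha1 ha2 ha3 ↦ ?_⟩
  replace ha2 : 2 * a < p i ^ m i := ha2
  have haS : a ∈ S i :=
    Finset.mem_filter.mpr ⟨Finset.mem_range.mpr (by omega), ha1, ha2, ha3⟩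
  have := exponent_eq_zero_of_const (hp i) (c := F i 1) (β := fun a ↦ β i a) (hS i)
    (fun b ↦ by simpa [F, hα i] using hconst i b) haS
  exact_mod_cast this
end
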